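/- arXiv:1507.00173 — 3 statements merged into one kernel-verified Lean document; each statement's English description precedes it below -/
import Mathlib

section
/- Let G be a finite simple 𝓕-free graph that contains a 5-hole, and suppose every 5-hole of G is dominating. Then G is near-bipartite. -/
open Finset SimpleGraph

/-- A set of vertices is stable (independent) if no two of its vertices are adjacent. -/
def IsStable {V : Type} (G : SimpleGraph V) (S : Set V) : Prop :=
  ∀ ⦃u⦄, u ∈ S → ∀ ⦃v⦄, v ∈ S → ¬ G.Adj u v

/-- The characteristic vector of a set of vertices. -/
noncomputable def charVec {V : Type} (S : Set V) : V → ℝ :=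
  S.indicator 1

/-- The stable set polytope: the convex hull of characteristic vectors of stable sets. -/
noncomputable def SSP {V : Type} (G : SimpleGraph V) : Set (V → ℝ) :=
  convexHull ℝ (charVec '' {S : Set V | IsStable G S})

/-- `C` is the vertex set of an induced cycle of `G`. -/
def IsInducedCycle {V : Type} (G : SimpleGraph V) (C : Finset V) : Prop :=
  3 ≤ C.card ∧ Nonempty (cycleGraph C.card ≃g G.induce (C : Set V))

/-- The polytope given by non-negativity, edge and odd-cycle constraints. -/
def TSTAB {V : Type} (G : SimpleGraph V) : Set (V → ℝ) :=
  {x | (∀ v, 0 ≤ x v) ∧ (∀ u v, G.Adj u v → x u + x v ≤ 1) ∧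
    ∀ C : Finset V, IsInducedCycle G C → Odd C.card →
      ∑ v ∈ C, x v ≤ ((C.card / 2 : ℕ) : ℝ)}

/-- A graph is t-perfect if its stable set polytope coincides with `TSTAB`. -/
def TPerfect {V : Type} (G : SimpleGraph V) : Prop :=
  SSP G = TSTAB G

/-- `G` contains `H` as an induced subgraph. -/
def HasInducedSubgraph {V W : Type} (G : SimpleGraph V) (H : SimpleGraph W) : Prop :=
  Nonempty (H ↪g G)

/-- A graph is P5-free if it contains no induced path on five vertices. -/
def P5Free {V : Type} (G : SimpleGraph V) : Prop :=
  ¬ HasInducedSubgraph G (pathGraph 5)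

/-- circular distance: min(|i-j|, n-|i-j|). -/
def circDist (n : ℕ) (i j : Fin n) : ℕ :=
  min ((i.val + n - j.val) % n) ((j.val + n - i.val) % n)

/-- The k-th power of the n-cycle: distinct i,j adjacent iff circular distance ≤ k. -/
def cyclePower (n k : ℕ) : SimpleGraph (Fin n) :=
  SimpleGraph.fromRel (fun i j => circDist n i j ≤ k)

/-- The antiweb: distinct i,j adjacent iff circular distance > k. -/
def antiweb (n k : ℕ) : SimpleGraph (Fin n) :=
  SimpleGraph.fromRel (fun i j => k < circDist n i j)

/-- The wheel W_n: the cycle C_n together with a hub adjacent to all cycle vertices. -/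
def wheel (n : ℕ) : SimpleGraph (Fin (n + 1)) :=
  SimpleGraph.fromRel (fun i j =>
    (i.val < n ∧ j.val < n ∧ (i.val + 1) % n = j.val) ∨ i.val = n ∨ j.val = n)

/-- The graph obtained from `G` by simultaneously contracting all edges incident
with the vertex `v`: the vertices of the neighbourhood of `v` get merged into `v`. -/
def tContract {V : Type} (G : SimpleGraph V) (v : V) :
    SimpleGraph {u : V // u ∉ G.neighborSet v} :=
  SimpleGraph.fromRel (fun a b =>
    (a.val = v ∧ ∃ w, (w = v ∨ G.Adj v w) ∧ G.Adj w b.val) ∨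
    (a.val ≠ v ∧ G.Adj a.val b.val))

/-- `IsTMinor H G`: `H` is (isomorphic to) a t-minor of `G`, i.e. obtainable from `G`
by a sequence of vertex deletions and of t-contractions at vertices with stable
neighbourhood. -/
inductive IsTMinor : {W : Type} → SimpleGraph W → {V : Type} → SimpleGraph V → Prop
  | of_iso {W V : Type} {H : SimpleGraph W} {G : SimpleGraph V} (e : H ≃g G) : IsTMinor H G
  | delete {W V : Type} {H : SimpleGraph W} {G : SimpleGraph V} (v : V)
      (h : IsTMinor H (G.induce {u | u ≠ v})) : IsTMinor H G
  | contract {W V : Type} {H : SimpleGraph W} {G : SimpleGraph V} (v : V)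
      (hst : IsStable G (G.neighborSet v))
      (h : IsTMinor H (tContract G v)) : IsTMinor H G

/-- An induced path in `G`. -/
def IsInducedPath {V : Type} (G : SimpleGraph V) {u v : V} (p : G.Walk u v) : Prop :=
  p.IsPath ∧ p.toSubgraph.IsInduced

/-- A tuple `(X 0, …, X (s-1))` of disjoint vertex sets is `G`-harmonious if every
induced path with one endvertex in `X i` and the other in `X j` has even length iff
`i = j`, and, when `s ≥ 3`, the parts are pairwise complete to each other. -/
def Harmonious {V : Type} (G : SimpleGraph V) {s : ℕ} (X : Fin s → Set V) : Prop :=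
  (∀ i j, i ≠ j → Disjoint (X i) (X j)) ∧
  (∀ i j (u v : V) (p : G.Walk u v), u ∈ X i → v ∈ X j → IsInducedPath G p →
      (Even p.length ↔ i = j)) ∧
  (3 ≤ s → ∀ i j, i ≠ j → ∀ u ∈ X i, ∀ v ∈ X j, G.Adj u v)

/-- `X` is a harmonious cutset of `G`. -/
def IsHarmoniousCutset {V : Type} (G : SimpleGraph V) (X : Set V) : Prop :=
  (∃ V1 V2 : Set V, V1 ∪ V2 = Set.univ ∧ (V1 \ V2).Nonempty ∧ (V2 \ V1).Nonempty ∧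
    (∀ u ∈ V1 \ V2, ∀ v ∈ V2 \ V1, ¬ G.Adj u v) ∧ X = V1 ∩ V2) ∧
  (∃ (s : ℕ) (Xp : Fin s → Set V), (⋃ i, Xp i) = X ∧ Harmonious G Xp)

/-- A 5-cycle `c1 c2 c3 c4 c5` (vertices `0,…,4`) plus a vertex adjacent exactly to
`c1, c2, c3`. -/
def graphA : SimpleGraph (Fin 6) :=
  SimpleGraph.fromRel (fun i j =>
    (i.val < 5 ∧ j.val < 5 ∧ (i.val + 1) % 5 = j.val) ∨ (i = 5 ∧ (j = 0 ∨ j = 1 ∨ j = 2)))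

/-- A 5-cycle `c1 c2 c3 c4 c5` (vertices `0,…,4`) plus a vertex adjacent exactly to
`c1, c2, c3, c4`. -/
def graphB : SimpleGraph (Fin 6) :=
  SimpleGraph.fromRel (fun i j =>
    (i.val < 5 ∧ j.val < 5 ∧ (i.val + 1) % 5 = j.val) ∨
    (i = 5 ∧ (j = 0 ∨ j = 1 ∨ j = 2 ∨ j = 3)))

/-- A 5-cycle `v0 v1 v2 v3 v4` (vertices `0,…,4`) plus vertices `u = 5`, `v = 6`, `x = 7`,
where `u` is adjacent exactly to `v0, v1, v3, x`, `v` is adjacent exactly to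
`v1, v3, v4, x`, and `x` is adjacent exactly to `u, v`. -/
def graphC : SimpleGraph (Fin 8) :=
  SimpleGraph.fromRel (fun i j =>
    (i.val < 5 ∧ j.val < 5 ∧ (i.val + 1) % 5 = j.val) ∨
    (i = 5 ∧ (j = 0 ∨ j = 1 ∨ j = 3 ∨ j = 7)) ∨
    (i = 6 ∧ (j = 1 ∨ j = 3 ∨ j = 4 ∨ j = 7)))

/-- `G` contains none of the nine graphs of the family 𝓕 as an induced subgraph. -/
def FFree {V : Type} (G : SimpleGraph V) : Prop :=
  ¬ HasInducedSubgraph G (pathGraph 5) ∧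
  ¬ HasInducedSubgraph G (completeGraph (Fin 4)) ∧
  ¬ HasInducedSubgraph G (wheel 5) ∧
  ¬ HasInducedSubgraph G (cyclePower 7 2) ∧
  ¬ HasInducedSubgraph G (antiweb 10 2) ∧
  ¬ HasInducedSubgraph G (antiweb 13 3) ∧
  ¬ HasInducedSubgraph G graphA ∧
  ¬ HasInducedSubgraph G graphB ∧
  ¬ HasInducedSubgraph G graphC

/-- `c` enumerates an induced 5-cycle (a 5-hole) of `G`. -/
def IsFiveHole {V : Type} (G : SimpleGraph V) (c : ZMod 5 → V) : Prop :=
  Function.Injective c ∧ ∀ i j, G.Adj (c i) (c j) ↔ (j = i + 1 ∨ i = j + 1)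

/-- A graph is near-bipartite if deleting the neighbourhood of any vertex leaves a
bipartite graph. -/
def NearBipartite {V : Type} (G : SimpleGraph V) : Prop :=
  ∀ v : V, (G.induce {u | u ∉ G.neighborSet v}).Colorable 2
/-- A map preserving and reflecting adjacency is an induced embedding when no two vertices of
the source have the same neighbourhood. -/
lemma hasInducedSubgraph_of_adj_iff {V W : Type} {G : SimpleGraph V} {H : SimpleGraph W}
    (htwin : ∀ i j, (∀ k, H.Adj i k ↔ H.Adj j k) → i = j) (f : W → V)
    (hf : ∀ i j, G.Adj (f i) (f j) ↔ H.Adj i j) : HasInducedSubgraph G H :=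
  ⟨⟨⟨f, fun i j hij => htwin i j fun k => by rw [← hf, ← hf, hij]⟩, fun {i j} => hf i j⟩⟩

/-- The vertices `a b c d e` form, in this order, an induced 5-cycle. -/
structure Hole {V : Type} (G : SimpleGraph V) (a b c d e : V) : Prop where
  ab : G.Adj a b
  bc : G.Adj b c
  cd : G.Adj c d
  de : G.Adj d e
  ea : G.Adj e a
  ac : ¬ G.Adj a c
  bd : ¬ G.Adj b d
  ce : ¬ G.Adj c e
  da : ¬ G.Adj d a
  eb : ¬ G.Adj e b

/-- The consequences of being `𝓕`-free with all 5-holes dominating that force near-bipartiteness. -/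
structure Restricted {V : Type} (G : SimpleGraph V) : Prop where
  path : ∀ {a b c d e}, G.Adj a b → G.Adj b c → G.Adj c d → G.Adj d e →
    ¬ G.Adj a c → ¬ G.Adj a d → ¬ G.Adj a e → ¬ G.Adj b d → ¬ G.Adj b e → ¬ G.Adj c e → False
  clique : ∀ {a b c d}, G.Adj a b → G.Adj a c → G.Adj a d → G.Adj b c → G.Adj b d →
    G.Adj c d → False
  not_three : ∀ {a b c d e}, Hole G a b c d e → ∀ x, G.Adj x a → G.Adj x b → ¬ G.Adj x c
  exists_adj : ∀ {a b c d e}, Hole G a b c d e → ∀ x,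
    G.Adj x a ∨ G.Adj x b ∨ G.Adj x c ∨ G.Adj x d ∨ G.Adj x e

section

variable {V : Type} {G : SimpleGraph V} {a b c d e : V}

lemma Hole.rotate (h : Hole G a b c d e) : Hole G b c d e a :=
  ⟨h.bc, h.cd, h.de, h.ea, h.ab, h.bd, h.ce, h.da, h.eb, h.ac⟩

lemma Hole.reflect (h : Hole G a b c d e) : Hole G e d c b a :=
  ⟨h.de.symm, h.cd.symm, h.bc.symm, h.ab.symm, h.ea.symm,
    fun k => h.ce k.symm, fun k => h.bd k.symm, fun k => h.ac k.symm,
    fun k => h.eb k.symm, fun k => h.da k.symm⟩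

/-- A vertex with the same two neighbours on a 5-hole as `a` can replace `a`. -/
lemma Hole.replace (h : Hole G a b c d e) {x : V} (xb : G.Adj x b) (xe : G.Adj x e)
    (xc : ¬ G.Adj x c) (xd : ¬ G.Adj x d) : Hole G x b c d e :=
  ⟨xb, h.bc, h.cd, h.de, xe.symm, xc, h.bd, h.ce, fun k => xd k.symm, h.eb⟩

lemma zmod_five_cases : ∀ i : ZMod 5, i = 0 ∨ i = 1 ∨ i = 2 ∨ i = 3 ∨ i = 4 := by
  decide

lemma isFiveHole_iff {f : ZMod 5 → V} :
    IsFiveHole G f ↔ Hole G (f 0) (f 1) (f 2) (f 3) (f 4) := by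
  have key : ∀ i j : ZMod 5, (∀ k, (k = i + 1 ∨ i = k + 1) ↔ (k = j + 1 ∨ j = k + 1)) → i = j := by
    decide
  constructor
  · rintro ⟨-, h⟩
    constructor <;> rw [h] <;> decide
  · intro h
    have hf : ∀ i j, G.Adj (f i) (f j) ↔ (j = i + 1 ∨ i = j + 1) := by
      obtain ⟨ab, bc, cd, de, ea, ac, bd, ce, da, eb⟩ := h
      intro i j
      rcases zmod_five_cases i with rfl | rfl | rfl | rfl | rfl <;>
      rcases zmod_five_cases j with rfl | rfl | rfl | rfl | rfl <;>
      first
      | exact iff_of_true (by first | assumption | (apply SimpleGraph.Adj.symm; assumption))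
          (by decide)
      | exact iff_of_false (by first | assumption | (rw [G.adj_comm]; assumption) | exact G.irrefl)
          (by decide)
    exact ⟨fun i j hij => key i j fun k => by rw [← hf, ← hf, hij], hf⟩

/-- A 5-hole with an additional vertex `x` induces `H` when `H` is a 5-cycle with an additional
vertex whose neighbourhood agrees with that of `x`. -/
lemma Hole.hasInducedSubgraph {H : SimpleGraph (Fin 6)} (h : Hole G a b c d e) {x : V}
    (htwin : ∀ i j, (∀ k, H.Adj i k ↔ H.Adj j k) → i = j)
    (hH : ∀ i j : Fin 5, H.Adj i.castSucc j.castSucc ↔ (j = i + 1 ∨ i = j + 1))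
    (ha : G.Adj x a ↔ H.Adj 5 0) (hb : G.Adj x b ↔ H.Adj 5 1) (hc : G.Adj x c ↔ H.Adj 5 2)
    (hd : G.Adj x d ↔ H.Adj 5 3) (he : G.Adj x e ↔ H.Adj 5 4) : HasInducedSubgraph G H := by
  let f : Fin 5 → V := ![a, b, c, d, e]
  have hf : IsFiveHole G f := isFiveHole_iff.2 h
  have hx : ∀ i : Fin 5, G.Adj x (f i) ↔ H.Adj (Fin.last 5) i.castSucc := by
    intro i
    fin_cases i
    exacts [ha, hb, hc, hd, he]
  refine hasInducedSubgraph_of_adj_iff htwin (Fin.snoc (α := fun _ => V) f x) fun i j => ?_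
  induction i using Fin.lastCases with
  | last =>
    induction j using Fin.lastCases with
    | last => simp
    | cast j => rw [Fin.snoc_last, Fin.snoc_castSucc, hx]
  | cast i =>
    induction j using Fin.lastCases with
    | last => rw [Fin.snoc_last, Fin.snoc_castSucc, G.adj_comm, hx, H.adj_comm]
    | cast j =>
      rw [Fin.snoc_castSucc, Fin.snoc_castSucc, hH]
      exact hf.2 i j

instance : DecidableRel (wheel 5).Adj := fun _ _ => decidable_of_iff' _ (fromRel_adj _ _ _)

instance : DecidableRel graphA.Adj := fun _ _ => decidable_of_iff' _ (fromRel_adj _ _ _)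

instance : DecidableRel graphB.Adj := fun _ _ => decidable_of_iff' _ (fromRel_adj _ _ _)

lemma restricted_of_fFree (hF : FFree G)
    (hdom : ∀ c : ZMod 5 → V, IsFiveHole G c → ∀ v ∉ Set.range c, ∃ i, G.Adj v (c i)) :
    Restricted G := by
  obtain ⟨hP, hK, hW, -, -, -, hA, hB, -⟩ := hF
  refine ⟨fun {a b c d e} ab bc cd de ac ad ae bd be ce => hP ?_,
    fun {a b c d} ab ac ad bc bd cd => hK ?_, fun {a b c d e} h x xa xb xc => ?_,
    fun {a b c d e} h x => ?_⟩
  · refine hasInducedSubgraph_of_adj_iff (by simp only [pathGraph_adj]; decide)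
      ![a, b, c, d, e] fun i j => ?_
    rw [pathGraph_adj]
    fin_cases i <;> fin_cases j <;> simp_all [G.adj_comm]
  · refine hasInducedSubgraph_of_adj_iff (by simp only [completeGraph, top_adj]; decide)
      ![a, b, c, d] fun i j => ?_
    fin_cases i <;> fin_cases j <;> simp_all [G.adj_comm]
  · by_cases xd : G.Adj x d <;> by_cases xe : G.Adj x e
    · exact hW (h.hasInducedSubgraph (by decide) (by decide) (iff_of_true xa (by decide))
        (iff_of_true xb (by decide)) (iff_of_true xc (by decide)) (iff_of_true xd (by decide))
        (iff_of_true xe (by decide)))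
    · exact hB (h.hasInducedSubgraph (by decide) (by decide) (iff_of_true xa (by decide))
        (iff_of_true xb (by decide)) (iff_of_true xc (by decide)) (iff_of_true xd (by decide))
        (iff_of_false xe (by decide)))
    · exact hB (h.rotate.rotate.rotate.rotate.hasInducedSubgraph (by decide) (by decide)
        (iff_of_true xe (by decide)) (iff_of_true xa (by decide)) (iff_of_true xb (by decide))
        (iff_of_true xc (by decide)) (iff_of_false xd (by decide)))
    · exact hA (h.hasInducedSubgraph (by decide) (by decide) (iff_of_true xa (by decide))
        (iff_of_true xb (by decide)) (iff_of_true xc (by decide)) (iff_of_false xd (by decide))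
        (iff_of_false xe (by decide)))
  · let f : ZMod 5 → V := ![a, b, c, d, e]
    by_cases hx : x ∈ Set.range f
    · obtain ⟨i, rfl⟩ := hx
      rcases zmod_five_cases i with rfl | rfl | rfl | rfl | rfl
      · exact .inr <| .inl h.ab
      · exact .inl h.ab.symm
      · exact .inr <| .inl h.bc.symm
      · exact .inr <| .inr <| .inl h.cd.symm
      · exact .inl h.ea
    · obtain ⟨i, hi⟩ := hdom f (isFiveHole_iff.2 h) x hx
      rcases zmod_five_cases i with rfl | rfl | rfl | rfl | rfl
      · exact .inl hi
      · exact .inr <| .inl hi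
      · exact .inr <| .inr <| .inl hi
      · exact .inr <| .inr <| .inr <| .inl hi
      · exact .inr <| .inr <| .inr <| .inr hi

/-- Neighbours of a vertex on a 5-hole have further neighbours at distance two. -/
lemma Restricted.adj_dist_two (hG : Restricted G) (h : Hole G a b c d e) {x : V}
    (xa : G.Adj x a) : G.Adj x c ∨ G.Adj x d := by
  by_contra! hx
  by_cases xb : G.Adj x b
  · by_cases xe : G.Adj x e
    · exact hG.not_three h.rotate.rotate.rotate.rotate x xe xa xb
    · exact hG.path xb h.bc h.cd h.de hx.1 hx.2 xe h.bd (fun k => h.eb k.symm) h.ce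
  · exact hG.path xa h.ab h.bc h.cd xb hx.1 hx.2 h.ac (fun k => h.da k.symm) h.bd

/-- Two vertices with a common pair of neighbours `a`, `c` on a 5-hole, both non-adjacent to the
hole vertex `d`, are not adjacent. -/
lemma Restricted.not_adj_of_common (hG : Restricted G) (h : Hole G a b c d e) {x y : V}
    (xa : G.Adj x a) (xc : G.Adj x c) (xd : ¬ G.Adj x d)
    (ya : G.Adj y a) (yc : G.Adj y c) (yd : ¬ G.Adj y d) : ¬ G.Adj x y := by
  intro xy
  by_cases xe : G.Adj x e
  · by_cases ye : G.Adj y e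
    · exact hG.clique xy xa xe ya ye h.ea.symm
    · exact hG.not_three (h.rotate.replace yc ya yd ye).reflect.rotate.rotate.rotate x xc xy xa
  · exact hG.not_three (h.rotate.replace xc xa xd xe).rotate.rotate.rotate.rotate y ya xy.symm yc

/-- A graph covered by three stable sets is bipartite if no vertex of the third has neighbours
in both of the others. -/
lemma colorable_two_of_three_stable {W : Type} {H : SimpleGraph W} (P Q R : W → Prop)
    (hcover : ∀ x, P x ∨ Q x ∨ R x) (hP : ∀ x y, P x → P y → ¬ H.Adj x y)
    (hQ : ∀ x y, Q x → Q y → ¬ H.Adj x y) (hR : ∀ x y, R x → R y → ¬ H.Adj x y)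
    (hPQR : ∀ x y z, R x → P y → Q z → H.Adj x y → ¬ H.Adj x z) : H.Colorable 2 := by
  classical
  let C : H.Coloring Prop := Coloring.mk (fun x => P x ∨ (R x ∧ ∀ y, P y → ¬ H.Adj x y)) (by
    intro x y hxy hC
    have hyx := hxy.symm
    grind)
  simpa using C.colorable

/-- In a restricted graph, the non-neighbours of a vertex on a 5-hole induce a bipartite graph. -/
lemma Restricted.colorable_of_mem_hole (hG : Restricted G) {v : V} (h : Hole G v b c d e) :
    (G.induce {u | u ∉ G.neighborSet v}).Colorable 2 := by
  refine colorable_two_of_three_stable (fun u => G.Adj u b ∧ G.Adj u d)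
    (fun u => G.Adj u c ∧ G.Adj u e)
    (fun u => G.Adj u b ∧ G.Adj u e ∧ ¬ G.Adj u c ∧ ¬ G.Adj u d) ?_ ?_ ?_ ?_ ?_
  · rintro ⟨u, hu⟩
    have hu : ¬ G.Adj u v := fun k => hu k.symm
    have hb := hG.adj_dist_two h.rotate (x := u)
    have hc := hG.adj_dist_two h.rotate.rotate (x := u)
    have hd := hG.adj_dist_two h.rotate.rotate.rotate (x := u)
    have he := hG.adj_dist_two h.rotate.rotate.rotate.rotate (x := u)
    have := hG.exists_adj h u
    dsimp only
    tauto
  · rintro ⟨x, hx⟩ ⟨y, hy⟩ ⟨xb, xd⟩ ⟨yb, yd⟩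
    exact hG.not_adj_of_common h.reflect.rotate xd xb (fun k => hx k.symm)
      yd yb fun k => hy k.symm
  · rintro ⟨x, hx⟩ ⟨y, hy⟩ ⟨xc, xe⟩ ⟨yc, ye⟩
    exact hG.not_adj_of_common h.rotate.rotate xc xe (fun k => hx k.symm)
      yc ye fun k => hy k.symm
  · rintro ⟨x, hx⟩ ⟨y, hy⟩ ⟨xb, xe, xc, -⟩ ⟨yb, ye, yc, -⟩
    exact hG.not_adj_of_common h.rotate.rotate.rotate.rotate xe xb xc ye yb yc
  · rintro ⟨x, hx⟩ ⟨y, hy⟩ ⟨z, hz⟩ ⟨xb, xe, xc, xd⟩ ⟨yb, yd⟩ ⟨zc, ze⟩ (xy : G.Adj x y)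
      (xz : G.Adj x z)
    have vy : ¬ G.Adj v y := hy
    have zv : ¬ G.Adj z v := fun k => hz k.symm
    have hX : Hole G x b c d e := h.replace xb xe xc xd
    have ye : ¬ G.Adj y e := fun k =>
      hG.not_three hX.rotate.rotate.rotate y yd k xy.symm
    have zb : ¬ G.Adj z b :=
      hG.not_three hX.rotate.rotate.rotate.rotate z ze xz.symm
    have yc : ¬ G.Adj y c := fun k => hG.not_three h.rotate y yb k yd
    have zd : ¬ G.Adj z d := fun k => hG.not_three h.rotate.rotate z zc k ze
    by_cases yz : G.Adj y z
    · have hN : Hole G v b y z e :=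
        ⟨h.ab, yb.symm, yz, ze, h.ea, vy, fun k => zb k.symm, ye, zv, h.eb⟩
      exact hG.not_three hN.rotate x xb xy xz
    · exact hG.path ze.symm zc h.bc.symm yb.symm (fun k => h.ce k.symm) h.eb
        (fun k => ye k.symm) zb (fun k => yz k.symm) fun k => yc k.symm

/-- In a restricted graph, the non-neighbours of a vertex adjacent to a hole vertex and to the two
hole vertices opposite to it induce a bipartite graph. -/
lemma Restricted.colorable_of_adj_opposite (hG : Restricted G) (h : Hole G a b c d e) {v : V}
    (va : G.Adj v a) (vc : G.Adj v c) (vd : G.Adj v d) :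
    (G.induce {u | u ∉ G.neighborSet v}).Colorable 2 := by
  have vb : ¬ G.Adj v b := fun k => hG.not_three h v va k vc
  have ve : ¬ G.Adj v e := fun k => hG.not_three h.rotate.rotate.rotate v vd k va
  by_cases hc : ∃ u, ¬ G.Adj v u ∧ G.Adj u b ∧ G.Adj u d ∧ ¬ G.Adj u a ∧ ¬ G.Adj u e
  · obtain ⟨u, vu, ub, ud, ua, ue⟩ := hc
    have hU : Hole G u d e a b := h.rotate.rotate.replace ud ub ue ua
    exact hG.colorable_of_mem_hole (hU.rotate.rotate.replace va vd vb vu)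
  by_cases hd : ∃ u, ¬ G.Adj v u ∧ G.Adj u c ∧ G.Adj u e ∧ ¬ G.Adj u a ∧ ¬ G.Adj u b
  · obtain ⟨u, vu, uc, ue, ua, ub⟩ := hd
    have hU : Hole G u e a b c := h.rotate.rotate.rotate.replace ue uc ua ub
    exact hG.colorable_of_mem_hole (hU.rotate.rotate.rotate.replace vc va vu ve)
  push Not at hc hd
  refine colorable_two_of_three_stable (fun u => G.Adj u a ∧ G.Adj u c ∧ ¬ G.Adj u d)
    (fun u => G.Adj u a ∧ G.Adj u d ∧ ¬ G.Adj u c)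
    (fun u => G.Adj u a ∧ G.Adj u c ∧ G.Adj u d) ?_ ?_ ?_ ?_ ?_
  · rintro ⟨u, hu⟩
    have vu : ¬ G.Adj v u := hu
    have ua : G.Adj u a := by
      by_contra ua
      obtain ⟨ub, ue⟩ : G.Adj u b ∧ G.Adj u e := by
        have ub_ue : G.Adj u b → G.Adj u e := fun ub =>
          (hG.adj_dist_two h.rotate ub).elim (fun ud => hc u vu ub ud ua) id
        have ue_ub : G.Adj u e → G.Adj u b := fun ue =>
          (hG.adj_dist_two h.rotate.rotate.rotate.rotate ue).elim id fun uc => hd u vu uc ue ua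
        rcases hG.exists_adj h u with k | k | k | k | k
        · exact absurd k ua
        · exact ⟨k, ub_ue k⟩
        · have ue := (hG.adj_dist_two h.rotate.rotate k).resolve_right ua
          exact ⟨ue_ub ue, ue⟩
        · have ub := (hG.adj_dist_two h.rotate.rotate.rotate k).resolve_left ua
          exact ⟨ub, ub_ue ub⟩
        · exact ⟨ue_ub k, k⟩
      have uv : ¬ G.Adj u v := fun k => vu k.symm
      by_cases uc : G.Adj u c
      · have ud : ¬ G.Adj u d := hG.not_three h.rotate u ub uc
        exact hG.path vd.symm va h.ab ub.symm h.da (fun k => h.bd k.symm)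
          (fun k => ud k.symm) vb vu fun k => ua k.symm
      · by_cases ud : G.Adj u d
        · exact hG.path vc.symm va h.ea.symm ue.symm (fun k => h.ac k.symm) h.ce
            (fun k => uc k.symm) ve vu fun k => ua k.symm
        · exact hG.path ub.symm ue h.de.symm vd.symm (fun k => h.eb k.symm) h.bd
            (fun k => vb k.symm) ud uv fun k => ve k.symm
    have := hG.adj_dist_two h ua
    dsimp only
    by_cases uc : G.Adj u c <;> by_cases ud : G.Adj u d <;> simp_all
  · rintro ⟨x, hx⟩ ⟨y, hy⟩ ⟨xa, xc, xd⟩ ⟨ya, yc, yd⟩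
    exact hG.not_adj_of_common h xa xc xd ya yc yd
  · rintro ⟨x, hx⟩ ⟨y, hy⟩ ⟨xa, xd, xc⟩ ⟨ya, yd, yc⟩
    exact hG.not_adj_of_common h.reflect.rotate.rotate.rotate.rotate xa xd xc ya yd yc
  · rintro ⟨x, hx⟩ ⟨y, hy⟩ ⟨-, xc, xd⟩ ⟨-, yc, yd⟩ xy
    exact hG.clique xy xc xd yc yd h.cd
  · rintro ⟨x, hx⟩ ⟨y, hy⟩ ⟨z, hz⟩ ⟨xa, xc, xd⟩ ⟨ya, yc, yd⟩ ⟨za, zd, zc⟩ (xy : G.Adj x y)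
      (xz : G.Adj x z)
    have ye : G.Adj y e := by
      by_contra ye
      exact hG.not_three (h.rotate.replace yc ya yd ye).rotate.rotate.rotate.rotate x xa xy xc
    have yb : ¬ G.Adj y b := fun k => hG.not_three h y ya k yc
    have ze : ¬ G.Adj z e := fun k => hG.not_three h.rotate.rotate.rotate z zd k za
    have zb : G.Adj z b := by
      by_contra zb
      have hZ := h.rotate.rotate.rotate.rotate.replace za zd zb zc
      exact hG.not_three hZ.rotate.rotate.rotate.rotate x xd xz xa
    by_cases yz : G.Adj y z
    · exact hG.clique xa.symm ya.symm za.symm xy xz yz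
    · exact hG.path ye.symm yc h.bc.symm zb.symm (fun k => h.ce k.symm) h.eb
        (fun k => ze k.symm) yb yz fun k => zc k.symm

end

/-- **Lemma 15.** An 𝓕-free graph containing a 5-hole, all of whose 5-holes are
dominating, is near-bipartite. -/
theorem ffree_dominating_nearBipartite {V : Type} [Fintype V] (G : SimpleGraph V)
    (hF : FFree G) (hex : ∃ c : ZMod 5 → V, IsFiveHole G c)
    (hdom : ∀ c : ZMod 5 → V, IsFiveHole G c → ∀ v ∉ Set.range c, ∃ i, G.Adj v (c i)) :
    NearBipartite G := by
  obtain ⟨f, hf⟩ := hex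
  have hG := restricted_of_fFree hF hdom
  have h := isFiveHole_iff.1 hf
  have key : ∀ {a b c d e : V}, Hole G a b c d e → ∀ v, G.Adj v a →
      (G.induce {u | u ∉ G.neighborSet v}).Colorable 2 := by
    intro a b c d e h v va
    by_cases vc : G.Adj v c
    · by_cases vd : G.Adj v d
      · exact hG.colorable_of_adj_opposite h va vc vd
      · by_cases ve : G.Adj v e
        · exact hG.colorable_of_adj_opposite h.rotate.rotate vc ve va
        · exact hG.colorable_of_mem_hole (h.rotate.replace vc va vd ve)
    · have vd : G.Adj v d := (hG.adj_dist_two h va).resolve_left vc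
      by_cases vb : G.Adj v b
      · exact hG.colorable_of_adj_opposite h.rotate.rotate.rotate vd va vb
      · exact hG.colorable_of_mem_hole (h.rotate.rotate.rotate.rotate.replace va vd vb vc)
  intro v
  rcases hG.exists_adj h v with k | k | k | k | k
  exacts [key h v k, key h.rotate v k, key h.rotate.rotate v k, key h.rotate.rotate.rotate v k,
    key h.rotate.rotate.rotate.rotate v k]
end

section
/- Every finite simple near-bipartite t-perfect graph is 4-colourable, i.e. admits a proper vertex colouring with 4 colours. -/
open Finset SimpleGraph

/-- A point whose coordinates are all `1 / 3` satisfies every constraint of `TSTAB`. -/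
lemma const_one_third_mem_TSTAB {V : Type} (G : SimpleGraph V) :
    (fun _ => 1 / 3 : V → ℝ) ∈ TSTAB G := by
  refine ⟨fun _ => by norm_num, fun _ _ _ => by norm_num, fun C hC hodd => ?_⟩
  obtain ⟨m, hm⟩ := hodd
  have h3 := hC.1
  have hm1 : (1 : ℝ) ≤ m := by exact_mod_cast (by lia : 1 ≤ m)
  rw [Finset.sum_const, hm, show (2 * m + 1) / 2 = m by lia, nsmul_eq_mul]
  push_cast
  linarith

/-- The sum of `f` over the endpoints of all edges of a walk. -/
noncomputable def walkWeight {W : Type} {H : SimpleGraph W} {a b : W} (f : W → ℝ)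
    (p : H.Walk a b) : ℝ :=
  (p.darts.map fun d => f d.fst + f d.snd).sum

section walkWeight

variable {W : Type} {H : SimpleGraph W} {a b : W}

lemma walkWeight_cons {c : W} (f : W → ℝ) (h : H.Adj a b) (p : H.Walk b c) :
    walkWeight f (Walk.cons h p) = f a + f b + walkWeight f p := by
  simp [walkWeight]

lemma walkWeight_add (f g : W → ℝ) (p : H.Walk a b) :
    walkWeight (fun x => f x + g x) p = walkWeight f p + walkWeight g p := by
  induction p with
  | nil => simp [walkWeight]
  | cons h p ih => simp only [walkWeight_cons, ih]; ring

lemma walkWeight_const_mul (r : ℝ) (f : W → ℝ) (p : H.Walk a b) :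
    walkWeight (fun x => r * f x) p = r * walkWeight f p := by
  induction p with
  | nil => simp [walkWeight]
  | cons h p ih => simp only [walkWeight_cons, ih]; ring

lemma walkWeight_const (r : ℝ) (p : H.Walk a b) :
    walkWeight (fun _ => r) p = 2 * r * p.length := by
  induction p with
  | nil => simp [walkWeight]
  | cons h p ih =>
    rw [walkWeight_cons, ih, Walk.length_cons]
    push_cast
    ring

lemma walkWeight_le_length {f : W → ℝ} (hf : ∀ x y, H.Adj x y → f x + f y ≤ 1)
    (p : H.Walk a b) : walkWeight f p ≤ p.length := by
  induction p with
  | nil => simp [walkWeight]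
  | cons h p ih =>
    rw [walkWeight_cons, Walk.length_cons]
    push_cast
    linarith [hf _ _ h]

/-- The weight of a walk under an integral function is even up to its end terms. -/
lemma exists_walkWeight_eq (f : W → ℤ) (p : H.Walk a b) :
    ∃ k : ℤ, walkWeight (fun x => (f x : ℝ)) p = 2 * k + f a - f b := by
  induction p with
  | nil => exact ⟨0, by simp [walkWeight]⟩
  | @cons a c b h p ih =>
    obtain ⟨k, hk⟩ := ih
    refine ⟨k + f c, ?_⟩
    rw [walkWeight_cons, hk]
    push_cast
    ring

lemma walkWeight_le_length_sub_one {f : W → ℤ} (hf : ∀ x y, H.Adj x y → f x + f y ≤ 1)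
    (p : H.Walk a a) (hodd : Odd p.length) :
    walkWeight (fun x => (f x : ℝ)) p ≤ p.length - 1 := by
  obtain ⟨k, hk⟩ := exists_walkWeight_eq f p
  have hle := walkWeight_le_length (f := fun x => (f x : ℝ))
    (fun x y h => by exact_mod_cast hf x y h) p
  obtain ⟨m, hm⟩ := hodd
  rw [hk, hm] at hle
  have hk2 : 2 * k ≤ 2 * (m : ℤ) + 1 := by
    have : (2 * k : ℝ) ≤ 2 * m + 1 := by push_cast at hle; linarith
    exact_mod_cast this
  have hkm : (k : ℝ) ≤ m := by exact_mod_cast (by lia : k ≤ (m : ℤ))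
  rw [hk, hm]
  push_cast
  linarith

end walkWeight

/-- The odd wheel inequality, for closed odd walks in the neighbourhood of a vertex. -/
lemma wheel_inequality_of_mem_SSP {V : Type} {G : SimpleGraph V} {v : V} {y : V → ℝ}
    (hy : y ∈ SSP G) {u : G.neighborSet v} (p : (G.induce (G.neighborSet v)).Walk u u)
    (hodd : Odd p.length) :
    walkWeight (fun x : G.neighborSet v => y x) p + (p.length - 1) * y v ≤ p.length - 1 := by
  have hlin : IsLinearMap ℝ
      (fun y : V → ℝ =>
        walkWeight (fun x : G.neighborSet v => y x) p + ((p.length : ℝ) - 1) * y v) := by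
    constructor
    · intro y z
      simp only [Pi.add_apply, walkWeight_add]
      ring
    · intro r y
      simp only [Pi.smul_apply, smul_eq_mul, walkWeight_const_mul]
      ring
  refine convexHull_min ?_ (convex_halfSpace_le hlin ((p.length : ℝ) - 1)) hy
  rintro _ ⟨S, hS, rfl⟩
  classical
  simp only [Set.mem_ofPred_eq]
  by_cases hv : v ∈ S
  · have h0 : (fun x : G.neighborSet v => charVec S x) = fun _ => 0 := by
      funext x
      exact Set.indicator_of_notMem (fun hx => hS hv hx x.2) _
    rw [h0, walkWeight_const]
    simp [charVec, hv]
  · have h1 : (fun x : G.neighborSet v => charVec S x) =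
        fun x : G.neighborSet v => (((if (x : V) ∈ S then 1 else 0 : ℤ)) : ℝ) := by
      funext x
      by_cases hx : (x : V) ∈ S <;> simp [charVec, hx]
    have hle := walkWeight_le_length_sub_one
      (f := fun x : G.neighborSet v => if (x : V) ∈ S then 1 else 0)
      (fun x z hxz => by
        have hnot : (x : V) ∈ S → (z : V) ∉ S := fun hx hz => hS hx hz hxz
        split_ifs <;> simp_all) p hodd
    rw [h1]
    simpa [charVec, hv] using hle

/-- In a t-perfect graph every vertex neighbourhood induces a bipartite graph. -/
lemma TPerfect.colorable_two_induce_neighborSet {V : Type} {G : SimpleGraph V}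
    (htp : TPerfect G) (v : V) : (G.induce (G.neighborSet v)).Colorable 2 := by
  rw [two_colorable_iff_forall_loop_even]
  intro u p
  by_contra hodd
  rw [Nat.not_even_iff_odd] at hodd
  have hmem : (fun _ => 1 / 3 : V → ℝ) ∈ SSP G := by
    rw [show SSP G = TSTAB G from htp]
    exact const_one_third_mem_TSTAB G
  have h := wheel_inequality_of_mem_SSP hmem p hodd
  rw [walkWeight_const] at h
  linarith

/-- If a vertex set and its complement induce graphs that are colourable with `m` and `n`
colours, then the whole graph is colourable with `m + n` colours. -/
lemma colorable_add_of_induce {V : Type} {G : SimpleGraph V} {s : Set V} {m n : ℕ}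
    (hs : (G.induce s).Colorable m) (hsc : (G.induce {u | u ∉ s}).Colorable n) :
    G.Colorable (m + n) := by
  classical
  obtain ⟨c⟩ := hs
  obtain ⟨d⟩ := hsc
  let e : G.Coloring (Fin m ⊕ Fin n) := Coloring.mk
    (fun x => if h : x ∈ s then Sum.inl (c ⟨x, h⟩) else Sum.inr (d ⟨x, h⟩)) (by
      intro x y hxy
      by_cases hx : x ∈ s <;> by_cases hy : y ∈ s <;> simp only [hx, hy, dite_true, dite_false,
        ne_eq, Sum.inl.injEq, Sum.inr.injEq, reduceCtorEq, not_false_eq_true]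
      · exact c.valid (v := ⟨x, hx⟩) (w := ⟨y, hy⟩) hxy
      · exact d.valid (v := ⟨x, hx⟩) (w := ⟨y, hy⟩) hxy)
  simpa using e.colorable

/-- **Proposition 18.** Every finite simple near-bipartite t-perfect graph is
4-colourable. -/
theorem nearBipartite_tperfect_colorable_four {V : Type} [Fintype V]
    (G : SimpleGraph V) (hnb : NearBipartite G) (htp : TPerfect G) :
    G.Colorable 4 := by
  cases isEmpty_or_nonempty V with
  | inl _ => exact Colorable.of_isEmpty 4
  | inr hV =>
    obtain ⟨v⟩ := hV
    exact colorable_add_of_induce (htp.colorable_two_induce_neighborSet v) (hnb v)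
end

section
/- Every finite simple P5-free t-perfect graph is 3-colourable, i.e. admits a proper vertex colouring with 3 colours. -/
open Finset SimpleGraph

section Polytope

variable {V W : Type}

/-- The relaxation of the stable set polytope given by the bounds `0 ≤ x ≤ 1` and the constraints
of edges, triangles and closed walks of length five. -/
def shortCycleRelaxation (G : SimpleGraph V) : Set (V → ℝ) :=
  {x | (∀ v, 0 ≤ x v) ∧ (∀ v, x v ≤ 1) ∧ (∀ u v, G.Adj u v → x u + x v ≤ 1) ∧
    (∀ u v w, G.Adj u v → G.Adj v w → G.Adj w u → x u + x v + x w ≤ 1) ∧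
    ∀ a b c d e, G.Adj a b → G.Adj b c → G.Adj c d → G.Adj d e → G.Adj e a →
      x a + x b + x c + x d + x e ≤ 2}

/-- The bounds and the constraints of odd cycles of length at most five suffice to describe the
stable set polytope. -/
def ShortCyclePerfect (G : SimpleGraph V) : Prop :=
  shortCycleRelaxation G ⊆ SSP G

lemma P5Free.comap {G : SimpleGraph V} (hG : P5Free G) (f : W ↪ V) : P5Free (G.comap f) :=
  fun ⟨e⟩ => hG ⟨e.trans (Embedding.comap f G)⟩

lemma P5Free.card_le_five {G : SimpleGraph V} (hG : P5Free G) {C : Finset V}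
    (hC : IsInducedCycle G C) : C.card ≤ 5 := by
  obtain ⟨-, ⟨e⟩⟩ := hC
  by_contra! h
  refine hG ⟨RelEmbedding.trans (⟨Fin.castLEEmb h.le, ?_⟩ : pathGraph 5 ↪g cycleGraph C.card)
    (e.toEmbedding.trans (Embedding.comap (Function.Embedding.subtype _) G))⟩
  intro a b
  rw [cycleGraph_adj', pathGraph_adj]
  simp only [Fin.castLEEmb_apply, Fin.val_sub, Fin.val_castLE]
  have ha := a.2
  have hb := b.2
  rcases lt_trichotomy a.val b.val with hab | hab | hab
  · rw [Nat.mod_eq_of_lt (a := C.card - b.val + a.val) (by lia)]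
    rw [show C.card - a.val + b.val = C.card + (b.val - a.val) by lia, Nat.add_mod_left,
      Nat.mod_eq_of_lt (by lia)]
    lia
  · rw [hab, Nat.sub_add_cancel (by lia), Nat.mod_self]
    lia
  · rw [Nat.mod_eq_of_lt (a := C.card - a.val + b.val) (by lia)]
    rw [show C.card - b.val + a.val = C.card + (a.val - b.val) by lia, Nat.add_mod_left,
      Nat.mod_eq_of_lt (by lia)]
    lia

lemma shortCycleRelaxation_subset_TSTAB {G : SimpleGraph V} (hG : P5Free G) :
    shortCycleRelaxation G ⊆ TSTAB G := by
  rintro x ⟨h0, -, h2, h3, h5⟩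
  refine ⟨h0, h2, fun C hC hodd => ?_⟩
  have hle := hG.card_le_five hC
  obtain ⟨hge, ⟨e⟩⟩ := hC
  have hsum : ∑ v ∈ C, x v = ∑ i, x (e i) := by
    rw [← Finset.sum_coe_sort C x]
    exact (Equiv.sum_comp e.toEquiv (fun v : C => x v)).symm
  rw [hsum]
  have key : ∀ i j, (cycleGraph C.card).Adj i j → G.Adj (e i) (e j) :=
    fun i j hij => e.map_rel_iff.2 hij
  generalize C.card = n at *
  obtain rfl | rfl : n = 3 ∨ n = 5 := by
    obtain ⟨m, rfl⟩ := hodd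
    lia
  · have := h3 (e 0) (e 1) (e 2) (key _ _ (by decide)) (key _ _ (by decide))
      (key _ _ (by decide))
    simpa [Fin.sum_univ_succ, add_assoc] using this
  · have := h5 (e 0) (e 1) (e 2) (e 3) (e 4) (key _ _ (by decide)) (key _ _ (by decide))
      (key _ _ (by decide)) (key _ _ (by decide)) (key _ _ (by decide))
    simpa [Fin.sum_univ_succ, add_assoc] using this

lemma TPerfect.shortCyclePerfect {G : SimpleGraph V} (htp : TPerfect G) (hG : P5Free G) :
    ShortCyclePerfect G :=
  (shortCycleRelaxation_subset_TSTAB hG).trans htp.ge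

lemma ShortCyclePerfect.comap {G : SimpleGraph V} (hG : ShortCyclePerfect G) (f : W ↪ V) :
    ShortCyclePerfect (G.comap f) := by
  classical
  rintro x ⟨h0, h1, h2, h3, h5⟩
  set y : V → ℝ := Function.extend f x 0 with hy
  have hyf : ∀ w, y (f w) = x w := fun w => f.injective.extend_apply _ _ _
  have hy0 : ∀ v, v ∉ Set.range f → y v = 0 := fun v hv => Function.extend_apply' _ _ _ hv
  have cases_v : ∀ v, (∃ w, f w = v) ∨ y v = 0 := fun v => by
    by_cases hv : v ∈ Set.range f
    · exact Or.inl hv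
    · exact Or.inr (hy0 v hv)
  have k0 : ∀ v, 0 ≤ y v := fun v => by
    rcases cases_v v with ⟨w, rfl⟩ | h
    · rw [hyf]; exact h0 w
    · rw [h]
  have k1 : ∀ v, y v ≤ 1 := fun v => by
    rcases cases_v v with ⟨w, rfl⟩ | h
    · rw [hyf]; exact h1 w
    · rw [h]; exact zero_le_one
  have k2 : ∀ u v, G.Adj u v → y u + y v ≤ 1 := fun u v huv => by
    rcases cases_v u with ⟨u, rfl⟩ | hu
    · rcases cases_v v with ⟨v, rfl⟩ | hv
      · rw [hyf, hyf]; exact h2 u v huv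
      · linarith [k1 (f u)]
    · linarith [k1 v]
  have hyG : y ∈ shortCycleRelaxation G := by
    refine ⟨k0, k1, k2, fun u v w huv hvw hwu => ?_, fun a b c d e hab hbc hcd hde hea => ?_⟩
    · rcases cases_v u with ⟨u, rfl⟩ | hu
      · rcases cases_v v with ⟨v, rfl⟩ | hv
        · rcases cases_v w with ⟨w, rfl⟩ | hw
          · simp only [hyf]; exact h3 u v w huv hvw hwu
          · linarith [k2 _ _ huv]
        · linarith [k2 _ _ hwu]
      · linarith [k2 _ _ hvw]
    · rcases cases_v a with ⟨a, rfl⟩ | ha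
      · rcases cases_v b with ⟨b, rfl⟩ | hb
        · rcases cases_v c with ⟨c, rfl⟩ | hc
          · rcases cases_v d with ⟨d, rfl⟩ | hd
            · rcases cases_v e with ⟨e, rfl⟩ | he
              · simp only [hyf]; exact h5 a b c d e hab hbc hcd hde hea
              · linarith [k2 _ _ hab, k2 _ _ hcd]
            · linarith [k2 _ _ hea, k2 _ _ hbc]
          · linarith [k2 _ _ hde, k2 _ _ hab]
        · linarith [k2 _ _ hcd, k2 _ _ hea]
      · linarith [k2 _ _ hbc, k2 _ _ hde]
  have hmem : LinearMap.funLeft ℝ ℝ f y ∈ LinearMap.funLeft ℝ ℝ f '' SSP G :=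
    Set.mem_image_of_mem _ (hG hyG)
  have hyx : LinearMap.funLeft ℝ ℝ f y = x := funext hyf
  rw [hyx, SSP, LinearMap.image_convexHull] at hmem
  refine convexHull_mono ?_ hmem
  rintro _ ⟨_, ⟨S, hS, rfl⟩, rfl⟩
  exact ⟨f ⁻¹' S, fun u hu v hv huv => hS hu hv huv, rfl⟩

lemma SSP_le {G : SimpleGraph V} (l : (V → ℝ) →ₗ[ℝ] ℝ) (b : ℝ)
    (h : ∀ S, IsStable G S → l (charVec S) ≤ b) {x : V → ℝ} (hx : x ∈ SSP G) : l x ≤ b :=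
  convexHull_min (by rintro _ ⟨S, hS, rfl⟩; exact h S hS) (convex_halfSpace_le l.isLinear b) hx

lemma SSP_lt {G : SimpleGraph V} (l : (V → ℝ) →ₗ[ℝ] ℝ) (b : ℝ)
    (h : ∀ S, IsStable G S → l (charVec S) < b) {x : V → ℝ} (hx : x ∈ SSP G) : l x < b :=
  convexHull_min (by rintro _ ⟨S, hS, rfl⟩; exact h S hS) (convex_halfSpace_lt l.isLinear b) hx

/-- Some stable set meets all triangles. -/
lemma ShortCyclePerfect.exists_stable_transversal [Fintype V] {G : SimpleGraph V}
    (hG : ShortCyclePerfect G) :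
    ∃ S : Set V, IsStable G S ∧
      ∀ u v w, G.Adj u v → G.Adj v w → G.Adj w u → u ∈ S ∨ v ∈ S ∨ w ∈ S := by
  classical
  by_contra! hcon
  have hx : (fun _ => 1 / 3 : V → ℝ) ∈ SSP G := hG (by
    refine ⟨?_, ?_, ?_, ?_, ?_⟩ <;> intros <;> norm_num)
  let T : Finset (V × V × V) :=
    {t | G.Adj t.1 t.2.1 ∧ G.Adj t.2.1 t.2.2 ∧ G.Adj t.2.2 t.1}
  let l : (V → ℝ) →ₗ[ℝ] ℝ :=
    ∑ t ∈ T, (LinearMap.proj (R := ℝ) (φ := fun _ : V => ℝ) t.1 + LinearMap.proj t.2.1 +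
      LinearMap.proj t.2.2)
  have hl : ∀ y, l y = ∑ t ∈ T, (y t.1 + y t.2.1 + y t.2.2) := fun y => by
    simp [l, LinearMap.sum_apply]
  have := SSP_lt l T.card (fun S hS => ?_) hx
  · rw [hl] at this
    norm_num at this
  · obtain ⟨u, v, w, huv, hvw, hwu, hu, hv, hw⟩ := hcon S hS
    rw [hl, Finset.card_eq_sum_ones, Nat.cast_sum]
    refine Finset.sum_lt_sum (fun t ht => ?_) ⟨(u, v, w), by simp [T, huv, hvw, hwu], ?_⟩
    · obtain ⟨h1, h2, h3⟩ : G.Adj t.1 t.2.1 ∧ G.Adj t.2.1 t.2.2 ∧ G.Adj t.2.2 t.1 := by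
        simpa [T] using ht
      have k1 := fun a b => hS (u := t.1) a (v := t.2.1) b h1
      have k2 := fun a b => hS (u := t.2.1) a (v := t.2.2) b h2
      have k3 := fun a b => hS (u := t.2.2) a (v := t.1) b h3
      simp only [charVec, Set.indicator_apply, Pi.one_apply]
      split_ifs <;> norm_num <;> tauto
    · simp [charVec, hu, hv, hw]

/-- A weight vector `w / k` in the relaxation of a finite graph that violates a valid inequality
`∑ i, a i * x i ≤ b` of its stable set polytope. -/
structure ViolatedInequality {n : ℕ} (M : Fin n → Fin n → Bool) (w a : Fin n → ℕ) (k b : ℕ) :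
    Prop where
  pos : 0 < k
  twinFree : ∀ i j, (∀ l, M i l = M j l) → i = j
  bound : ∀ i, w i ≤ k
  edge : ∀ i j, M i j = true → w i + w j ≤ k
  triangle : ∀ i j, M i j = true → ∀ l, M j l = true → M l i = true → w i + w j + w l ≤ k
  walk : ∀ i j, M i j = true → ∀ l, M j l = true → ∀ p, M l p = true → ∀ q, M p q = true →
    M q i = true → w i + w j + w l + w p + w q ≤ 2 * k
  valid : ∀ s : Fin n → Bool, (∀ i j, M i j = true → ¬ (s i = true ∧ s j = true)) →
    ∑ i, a i * (s i).toNat ≤ b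
  violated : b * k < ∑ i, a i * w i

lemma ViolatedInequality.not_shortCyclePerfect {G : SimpleGraph V} {n : ℕ}
    {M : Fin n → Fin n → Bool} {w a : Fin n → ℕ} {k b : ℕ} (h : ViolatedInequality M w a k b)
    (f : Fin n → V) (hf : ∀ i j, G.Adj (f i) (f j) ↔ M i j = true) : ¬ ShortCyclePerfect G := by
  classical
  intro hG
  have hinj : Function.Injective f := fun i j hij => h.twinFree i j fun l => by
    rw [Bool.eq_iff_iff, ← hf, ← hf, hij]
  have hk : (0 : ℝ) < k := by exact_mod_cast h.pos
  let x : Fin n → ℝ := fun i => (w i : ℝ) / k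
  have hx : x ∈ SSP (G.comap f) := hG.comap ⟨f, hinj⟩ (by
    have key : ∀ p q : ℕ, p ≤ q * k → (p : ℝ) / k ≤ q := fun p q hpq => by
      rw [div_le_iff₀ hk]; exact_mod_cast hpq
    refine ⟨fun i => by positivity, fun i => ?_, fun i j hij => ?_, fun i j l hij hjl hli => ?_,
      fun i j l p q hij hjl hlp hpq hqi => ?_⟩
    · simpa using key (w i) 1 (by simpa using h.bound i)
    · have := key _ 1 (by simpa using h.edge i j ((hf _ _).1 hij))
      push_cast at this
      simpa only [x, ← add_div] using this
    · have := key _ 1 (by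
        simpa using h.triangle i j ((hf _ _).1 hij) l ((hf _ _).1 hjl) ((hf _ _).1 hli))
      push_cast at this
      simpa only [x, ← add_div] using this
    · have := key _ 2 (h.walk i j ((hf _ _).1 hij) l ((hf _ _).1 hjl) p ((hf _ _).1 hlp) q
        ((hf _ _).1 hpq) ((hf _ _).1 hqi))
      push_cast at this
      simpa only [x, ← add_div] using this)
  let l : (Fin n → ℝ) →ₗ[ℝ] ℝ := ∑ i, (a i : ℝ) • LinearMap.proj i
  have hl : ∀ y, l y = ∑ i, a i * y i := fun y => by simp [l, LinearMap.sum_apply]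
  have := SSP_le l b (fun S hS => ?_) hx
  · rw [hl] at this
    simp only [x, ← mul_div_assoc, ← Finset.sum_div] at this
    rw [div_le_iff₀ hk] at this
    have h' := h.violated
    have : (∑ i, a i * w i) ≤ b * k := by exact_mod_cast this
    lia
  · rw [hl]
    have := h.valid (fun i => decide (i ∈ S)) (fun i j hij hs => by
      simp only [decide_eq_true_eq] at hs
      exact hS hs.1 hs.2 ((hf i j).2 hij))
    refine le_trans (le_of_eq ?_) (Nat.cast_le.2 this)
    push_cast
    refine Finset.sum_congr rfl fun i _ => ?_
    by_cases hi : i ∈ S <;> simp [charVec, hi]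

end Polytope

section ForbiddenSubgraphs

variable {V : Type} {G : SimpleGraph V} {c : ZMod 5 → V}

/-- The adjacency table of the graph on `Fin n` with the given edges. -/
def edgeTable (n : ℕ) (E : List (ℕ × ℕ)) (i j : Fin n) : Bool :=
  E.contains (i.val, j.val) || E.contains (j.val, i.val)

lemma P5Free.false_of_path (hG : P5Free G) {a b c d e : V} (hab : G.Adj a b) (hbc : G.Adj b c)
    (hcd : G.Adj c d) (hde : G.Adj d e) (hac : ¬ G.Adj a c) (had : ¬ G.Adj a d)
    (hae : ¬ G.Adj a e) (hbd : ¬ G.Adj b d) (hbe : ¬ G.Adj b e) (hce : ¬ G.Adj c e) : False := by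
  have hf : ∀ i j, G.Adj (![a, b, c, d, e] i) (![a, b, c, d, e] j) ↔ (pathGraph 5).Adj i j := by
    intro i j
    rw [pathGraph_adj]
    fin_cases i <;> fin_cases j <;>
      simp [hab, hbc, hcd, hde, hac, had, hae, hbd, hbe, hce, hab.symm, hbc.symm, hcd.symm,
        hde.symm, G.adj_comm c a, G.adj_comm d a, G.adj_comm e a, G.adj_comm d b, G.adj_comm e b,
        G.adj_comm e c]
  refine hG ⟨⟨⟨![a, b, c, d, e], fun i j hij => ?_⟩, hf _ _⟩⟩
  have h : ∀ k, (pathGraph 5).Adj i k ↔ (pathGraph 5).Adj j k := fun k => by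
    rw [← hf, ← hf, hij]
  simp only [pathGraph_adj] at h
  have twinFree : ∀ i j : Fin 5, (∀ k : Fin 5, i.val + 1 = k ∨ k.val + 1 = i ↔
      j.val + 1 = k ∨ k.val + 1 = j) → i = j := by decide
  exact twinFree i j h

lemma IsFiveHole.not_adj_all (hG : ShortCyclePerfect G) (hc : IsFiveHole G c) {v : V}
    (hv : ∀ j, G.Adj v (c j)) : False := by
  have h : ViolatedInequality (edgeTable 6 [(0, 1), (1, 2), (2, 3), (3, 4), (4, 0), (5, 0), (5, 1),
      (5, 2), (5, 3), (5, 4)]) ![2, 2, 2, 2, 2, 1] ![1, 1, 1, 1, 1, 2] 5 2 := by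
    constructor <;> decide
  refine h.not_shortCyclePerfect ![c 0, c 1, c 2, c 3, c 4, v] (fun i j => ?_) hG
  fin_cases i <;> fin_cases j <;> simp [hc.2, hv, (hv _).symm] <;> decide

lemma IsFiveHole.not_adj_four (hG : ShortCyclePerfect G) (hc : IsFiveHole G c) {v : V}
    (i : ZMod 5) (hv : ∀ j, G.Adj v (c j) ↔ j ≠ i) : False := by
  have h : ViolatedInequality (edgeTable 6 [(0, 1), (1, 2), (2, 3), (3, 4), (4, 0), (5, 1),
      (5, 2), (5, 3), (5, 4)]) ![2, 1, 1, 1, 1, 1] ![1, 1, 1, 1, 1, 1] 3 2 := by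
    constructor <;> decide
  refine h.not_shortCyclePerfect ![c i, c (1 + i), c (2 + i), c (3 + i), c (4 + i), v]
    (fun k j => ?_) hG
  fin_cases k <;> fin_cases j <;> simp [hc.2, hv, G.adj_comm (c _) v] <;> clear * - i <;>
    revert i <;> decide

lemma IsFiveHole.not_adj_three_consecutive (hG : ShortCyclePerfect G) (hc : IsFiveHole G c) {v : V}
    (i : ZMod 5) (hv : ∀ j, G.Adj v (c j) ↔ j = i ∨ j = i + 1 ∨ j = i - 1) : False := by
  have h : ViolatedInequality (edgeTable 6 [(0, 1), (1, 2), (2, 3), (3, 4), (4, 0), (5, 2),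
      (5, 3), (5, 1)]) ![2, 1, 1, 1, 1, 1] ![1, 1, 1, 1, 1, 1] 3 2 := by
    constructor <;> decide
  refine h.not_shortCyclePerfect
    ![c (3 + i), c (4 + i), c (0 + i), c (1 + i), c (2 + i), v] (fun k j => ?_) hG
  fin_cases k <;> fin_cases j <;> simp [hc.2, hv, G.adj_comm (c _) v] <;> clear * - i <;>
    revert i <;> decide

/-- `v` has the same neighbours on the 5-hole `c` as `c i`. -/
def IsHoleClone (G : SimpleGraph V) (c : ZMod 5 → V) (i : ZMod 5) (v : V) : Prop :=
  ∀ j, G.Adj v (c j) ↔ j = i + 1 ∨ j = i - 1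

/-- The neighbours of `v` on the 5-hole `c` are `c i` and the ends of the edge opposite to it. -/
def IsHoleApex (G : SimpleGraph V) (c : ZMod 5 → V) (i : ZMod 5) (v : V) : Prop :=
  ∀ j, G.Adj v (c j) ↔ j = i ∨ j = i + 2 ∨ j = i - 2

lemma IsHoleClone.adj_comm {i : ZMod 5} {v : V} (hv : IsHoleClone G c i v) (j : ZMod 5) :
    G.Adj (c j) v ↔ j = i + 1 ∨ j = i - 1 := by
  rw [G.adj_comm, hv]

lemma IsHoleApex.adj_comm {i : ZMod 5} {v : V} (hv : IsHoleApex G c i v) (j : ZMod 5) :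
    G.Adj (c j) v ↔ j = i ∨ j = i + 2 ∨ j = i - 2 := by
  rw [G.adj_comm, hv]

/-- The possible neighbourhoods on a 5-hole. -/
lemma IsFiveHole.classify (hP : P5Free G) (hG : ShortCyclePerfect G) (hc : IsFiveHole G c) (v : V) :
    (∀ j, ¬ G.Adj v (c j)) ∨ (∃ i, IsHoleClone G c i v) ∨ ∃ i, IsHoleApex G c i v := by
  classical
  have key : ∀ p : ZMod 5 → Bool, (∀ j, ¬ p j = true) ∨
      (∃ i, ∀ j, p j = true ↔ j = i + 1 ∨ j = i - 1) ∨
      (∃ i, ∀ j, p j = true ↔ j = i ∨ j = i + 2 ∨ j = i - 2) ∨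
      (∀ j, p j = true) ∨ (∃ i, ∀ j, p j = true ↔ j ≠ i) ∨
      (∃ i, ∀ j, p j = true ↔ j = i ∨ j = i + 1 ∨ j = i - 1) ∨
      (∃ i, ∀ j, p j = true ↔ j = i) ∨ (∃ i, ∀ j, p j = true ↔ j = i ∨ j = i + 1) := by
    decide
  have := key fun j => decide (G.Adj v (c j))
  simp only [decide_eq_true_eq] at this
  rcases this with h | h | h | h | ⟨i, h⟩ | ⟨i, h⟩ | ⟨i, h⟩ | ⟨i, h⟩
  · exact Or.inl h
  · exact Or.inr (Or.inl h)
  · exact Or.inr (Or.inr h)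
  · exact (hc.not_adj_all hG h).elim
  · exact (hc.not_adj_four hG i h).elim
  · exact (hc.not_adj_three_consecutive hG i h).elim
  · refine (hP.false_of_path (a := v) (b := c i) (c := c (i + 1)) (d := c (i + 2)) (e := c (i + 3))
      ?_ ?_ ?_ ?_ ?_ ?_ ?_ ?_ ?_ ?_).elim <;> simp only [h, hc.2] <;> clear * - i <;>
      revert i <;> decide
  · refine (hP.false_of_path (a := v) (b := c i) (c := c (i - 1)) (d := c (i - 2)) (e := c (i - 3))
      ?_ ?_ ?_ ?_ ?_ ?_ ?_ ?_ ?_ ?_).elim <;> simp only [h, hc.2] <;> clear * - i <;>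
      revert i <;> decide

set_option maxRecDepth 4000 in
/-- Two nonadjacent apexes at distinct vertices of a 5-hole have no common neighbour away from
the hole. -/
lemma IsHoleApex.not_common_adj (hG : ShortCyclePerfect G) (hc : IsFiveHole G c) {i j : ZMod 5}
    {u v z : V} (hu : IsHoleApex G c i u) (hv : IsHoleApex G c j v) (hij : i ≠ j)
    (huv : ¬ G.Adj u v) (hz : ∀ j, ¬ G.Adj z (c j)) (hzu : G.Adj z u) (hzv : G.Adj z v) :
    False := by
  wlog h : j = i + 1 ∨ j = i + 2 generalizing i j u v
  · refine this hv hu hij.symm (fun h => huv h.symm) hzv hzu ?_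
    have key : ∀ i j : ZMod 5, i ≠ j → ¬ (j = i + 1 ∨ j = i + 2) → i = j + 1 ∨ i = j + 2 := by
      decide
    exact key i j hij h
  have hz' : ∀ j, ¬ G.Adj (c j) z := fun j h => hz j h.symm
  rcases h with rfl | rfl
  · have h : ViolatedInequality (edgeTable 8 [(0, 1), (1, 2), (2, 3), (3, 4), (4, 0), (5, 0),
        (5, 2), (5, 3), (6, 1), (6, 3), (6, 4), (7, 5), (7, 6)]) ![2, 2, 2, 2, 2, 1, 1, 4]
        ![1, 1, 1, 1, 1, 2, 2, 2] 5 4 := by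
      constructor <;> decide
    refine h.not_shortCyclePerfect ![c (0 + i), c (1 + i), c (2 + i), c (3 + i), c (4 + i), u, v, z]
      (fun k j => ?_) hG
    fin_cases k <;> fin_cases j <;> simp [hc.2, hu _, hv _, hu.adj_comm, hv.adj_comm, huv, hz, hz',
      hzu, hzv, hzu.symm, hzv.symm, G.adj_comm v u] <;> clear * - i <;> revert i <;> decide
  · have h : ViolatedInequality (edgeTable 8 [(0, 1), (1, 2), (2, 3), (3, 4), (4, 0), (5, 0),
        (5, 2), (5, 3), (6, 2), (6, 4), (6, 0), (7, 5), (7, 6)]) ![1, 2, 1, 1, 1, 1, 1, 2]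
        ![1, 1, 1, 1, 1, 1, 1, 1] 3 3 := by
      constructor <;> decide
    refine h.not_shortCyclePerfect ![c (0 + i), c (1 + i), c (2 + i), c (3 + i), c (4 + i), u, v, z]
      (fun k j => ?_) hG
    fin_cases k <;> fin_cases j <;> simp [hc.2, hu _, hv _, hu.adj_comm, hv.adj_comm, huv, hz, hz',
      hzu, hzv, hzu.symm, hzv.symm, G.adj_comm v u] <;> clear * - i <;> revert i <;> decide

end ForbiddenSubgraphs

section Bipartite

variable {V : Type} {G : SimpleGraph V}

lemma isFiveHole_of_walk (h3 : ∀ u v w, G.Adj u v → G.Adj v w → ¬ G.Adj w u) {a b c d e : V}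
    (hab : G.Adj a b) (hbc : G.Adj b c) (hcd : G.Adj c d) (hde : G.Adj d e) (hea : G.Adj e a) :
    IsFiveHole G ![a, b, c, d, e] := by
  have hac : ¬ G.Adj a c := fun h => h3 _ _ _ hab hbc h.symm
  have hbd : ¬ G.Adj b d := fun h => h3 _ _ _ hbc hcd h.symm
  have hce : ¬ G.Adj c e := fun h => h3 _ _ _ hcd hde h.symm
  have hda : ¬ G.Adj d a := fun h => h3 _ _ _ hde hea h.symm
  have heb : ¬ G.Adj e b := fun h => h3 _ _ _ hea hab h.symm
  have hf : ∀ i j : Fin 5, G.Adj (![a, b, c, d, e] i) (![a, b, c, d, e] j) ↔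
      (j = i + 1 ∨ i = j + 1) := by
    intro i j
    fin_cases i <;> fin_cases j <;> simp [hab, hbc, hcd, hde, hea, hac, hbd, hce, hda, heb,
      hab.symm, hbc.symm, hcd.symm, hde.symm, hea.symm, G.adj_comm c a, G.adj_comm d b,
      G.adj_comm e c, G.adj_comm a d, G.adj_comm b e]
  refine ⟨fun i j hij => ?_, hf⟩
  have twinFree : ∀ i j : Fin 5, (∀ k : Fin 5, k = i + 1 ∨ i = k + 1 ↔ k = j + 1 ∨ j = k + 1) →
      i = j := by decide
  exact twinFree i j fun k =>
    (hf i k).symm.trans ((iff_of_eq (by rw [hij])).trans (hf j k))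

lemma P5Free.colorable_two (hP : P5Free G) (h3 : ∀ u v w, G.Adj u v → G.Adj v w → ¬ G.Adj w u)
    (h5 : ∀ c, ¬ IsFiveHole G c) : G.Colorable 2 := by
  rw [two_colorable_iff_forall_loop_even]
  suffices h : ∀ n, ∀ u, ∀ p : G.Walk u u, p.length = n → Even n from fun u p => h _ u p rfl
  intro n
  induction n using Nat.strong_induction_on with
  | _ n ih =>
    intro a p hp
    match p, hp with
    | .nil, hp => exact by simp [← hp]
    | .cons h .nil, _ => exact (G.irrefl h).elim
    | .cons _ (.cons _ .nil), hp => exact hp ▸ even_two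
    | .cons hab (.cons hbc (.cons hcd .nil)), _ => exact (h3 _ _ _ hab hbc hcd).elim
    | .cons (v := b) hab (.cons (v := c) hbc (.cons (v := d) hcd (.cons (v := e) hde q))), hp =>
      have hac : ¬ G.Adj a c := fun h => h3 _ _ _ hab hbc h.symm
      have hbd : ¬ G.Adj b d := fun h => h3 _ _ _ hbc hcd h.symm
      have hce : ¬ G.Adj c e := fun h => h3 _ _ _ hcd hde h.symm
      have hae : ¬ G.Adj a e := fun h => h5 _ (isFiveHole_of_walk h3 hab hbc hcd hde h.symm)
      simp only [Walk.length_cons] at hp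
      by_cases had : G.Adj a d
      · have := ih (n - 2) (by lia) a (.cons had (.cons hde q)) (by simp; lia)
        exact (Nat.even_sub (by lia)).1 this |>.2 even_two
      · by_cases hbe : G.Adj b e
        · have := ih (n - 2) (by lia) a (.cons hab (.cons hbe q)) (by simp; lia)
          exact (Nat.even_sub (by lia)).1 this |>.2 even_two
        · exact (hP.false_of_path hab hbc hcd hde hac had hae hbd hbe hce).elim

end Bipartite

section Structure

variable {V : Type} {G : SimpleGraph V} {c : ZMod 5 → V}

lemma IsFiveHole.update (hc : IsFiveHole G c) {i : ZMod 5} {u : V} (hu : IsHoleClone G c i u) :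
    IsFiveHole G (Function.update c i u) := by
  have hf : ∀ j k, G.Adj (Function.update c i u j) (Function.update c i u k) ↔
      (k = j + 1 ∨ j = k + 1) := by
    intro j k
    by_cases hj : j = i <;> by_cases hk : k = i
    · subst hj hk
      simp
      decide
    · subst hj
      rw [Function.update_self, Function.update_of_ne hk, hu k, eq_sub_iff_add_eq,
        eq_comm (b := j)]
    · subst hk
      rw [Function.update_self, Function.update_of_ne hj, hu.adj_comm j, eq_sub_iff_add_eq,
        eq_comm (b := k), or_comm]
    · rw [Function.update_of_ne hj, Function.update_of_ne hk, hc.2]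
  refine ⟨fun j k hjk => ?_, hf⟩
  have twinFree : ∀ j k : ZMod 5, (∀ l, l = j + 1 ∨ j = l + 1 ↔ l = k + 1 ∨ k = l + 1) →
      j = k := by decide
  exact twinFree j k fun l => by rw [← hf, ← hf, hjk]

lemma IsHoleClone.adj_of_succ (hP : P5Free G) (hc : IsFiveHole G c) {i : ZMod 5} {u w : V}
    (hu : IsHoleClone G c i u) (hw : IsHoleClone G c (i + 1) w) : G.Adj u w := by
  by_contra h
  have h' : ¬ G.Adj w u := fun hwu => h hwu.symm
  refine hP.false_of_path (a := w) (b := c (i + 2)) (c := c (i + 3)) (d := c (i + 4)) (e := u)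
    ?_ ?_ ?_ ?_ ?_ ?_ h' ?_ ?_ ?_ <;> simp only [hw _, hu.adj_comm, hc.2] <;> clear * - i <;>
    revert i <;> decide

lemma IsHoleClone.not_adj (hG : ShortCyclePerfect G) (hc : IsFiveHole G c) {i : ZMod 5} {u w : V}
    (hu : IsHoleClone G c i u) (hw : IsHoleClone G c i w) : ¬ G.Adj u w := by
  intro h
  refine (hc.update hu).not_adj_three_consecutive hG i (v := w) fun j => ?_
  by_cases hj : j = i
  · subst hj
    simp [h.symm]
  · rw [Function.update_of_ne hj, hw j]
    simp [hj]

lemma IsHoleApex.adj_clone (hP : P5Free G) (hc : IsFiveHole G c) {i : ZMod 5} {u y : V}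
    (hy : IsHoleApex G c i y) (hu : IsHoleClone G c i u) : G.Adj y u := by
  by_contra h
  refine hP.false_of_path (a := y) (b := c (i + 2)) (c := c (i + 1)) (d := u) (e := c (i - 1))
    ?_ ?_ ?_ ?_ ?_ h ?_ ?_ ?_ ?_ <;> simp only [hy _, hu _, hu.adj_comm, hc.2] <;>
    clear * - i <;> revert i <;> decide

lemma IsHoleApex.not_adj_clone_succ (hG : ShortCyclePerfect G) (hc : IsFiveHole G c) {i : ZMod 5}
    {u y : V} (hy : IsHoleApex G c i y) (hu : IsHoleClone G c (i + 1) u) : ¬ G.Adj y u := by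
  intro h
  refine (hc.update hu).not_adj_four hG (i - 1) (v := y) fun j => ?_
  by_cases hj : j = i + 1
  · subst hj
    simp only [Function.update_self, h, true_iff]
    clear * - i
    revert i
    decide
  · rw [Function.update_of_ne hj, hy j]
    clear * - hj
    revert i j
    decide

lemma IsHoleApex.not_adj_clone_pred (hG : ShortCyclePerfect G) (hc : IsFiveHole G c) {i : ZMod 5}
    {u y : V} (hy : IsHoleApex G c (i + 1) y) (hu : IsHoleClone G c i u) : ¬ G.Adj y u := by
  intro h
  refine (hc.update hu).not_adj_four hG (i + 2) (v := y) fun j => ?_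
  by_cases hj : j = i
  · subst hj
    simp only [Function.update_self, h, true_iff]
    clear * - j
    revert j
    decide
  · rw [Function.update_of_ne hj, hy j]
    clear * - hj
    revert i j
    decide

lemma IsHoleClone.not_adj_far (hP : P5Free G) (hc : IsFiveHole G c) {i : ZMod 5} {u z : V}
    (hu : IsHoleClone G c i u) (hz : ∀ j, ¬ G.Adj z (c j)) : ¬ G.Adj z u := by
  intro h
  refine hP.false_of_path (a := z) (b := u) (c := c (i + 1)) (d := c (i + 2)) (e := c (i + 3))
    h ?_ ?_ ?_ (hz _) (hz _) (hz _) ?_ ?_ ?_ <;> simp only [hu _, hc.2] <;>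
    clear * - i <;> revert i <;> decide

lemma IsHoleApex.adj_of_adj_far (hP : P5Free G) (hc : IsFiveHole G c) {i : ZMod 5} {y z z' : V}
    (hy : IsHoleApex G c i y) (hz : ∀ j, ¬ G.Adj z (c j)) (hz' : ∀ j, ¬ G.Adj z' (c j))
    (hzz' : G.Adj z z') (hzy : G.Adj z y) : G.Adj z' y := by
  by_contra h
  refine hP.false_of_path (a := z') (b := z) (c := y) (d := c i) (e := c (i + 1))
    hzz'.symm hzy ?_ ?_ h (hz' _) (hz' _) (hz _) (hz _) ?_ <;> simp only [hy _, hc.2] <;>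
    clear * - i <;> revert i <;> decide

/-- If the apexes of a 5-hole form a stable set, then they miss one of its vertices. -/
lemma IsFiveHole.exists_no_apex (hP : P5Free G) (hc : IsFiveHole G c) {S : Set V}
    (hS : IsStable G S) (hYS : ∀ i y, IsHoleApex G c i y → y ∈ S) :
    ∃ i, ∀ y, ¬ IsHoleApex G c i y := by
  by_contra! h
  obtain ⟨u, hu⟩ := h 3
  obtain ⟨v, hv⟩ := h 0
  obtain ⟨w, hw⟩ := h 4
  have huS := hYS _ _ hu
  have hvS := hYS _ _ hv
  have hwS := hYS _ _ hw
  refine hP.false_of_path (a := u) (b := c 0) (c := v) (d := c 2) (e := w)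
    ?_ ?_ ?_ ?_ (hS huS hvS) ?_ (hS huS hwS) ?_ ?_ (hS hvS hwS) <;>
    simp only [hu _, hv _, hv.adj_comm, hw.adj_comm, hc.2] <;> decide

/-- The colour of a clone may depend on its position and on its membership in `S`, the colour
of an apex on its position. -/
lemma exists_coloring_of_tables (hP : P5Free G) (hG : ShortCyclePerfect G) (hc : IsFiveHole G c)
    {S : Set V} [DecidablePred (· ∈ S)] (hS : IsStable G S)
    (hYS : ∀ i y, IsHoleApex G c i y → y ∈ S) (α : ZMod 5 → Bool → Fin 3) (β : ZMod 5 → Fin 3)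
    (h₁ : ∀ i s t, α i s ≠ α (i + 1) t)
    (h₂ : ∀ i u w, IsHoleClone G c i u → IsHoleClone G c (i + 2) w → G.Adj u w →
      α i (decide (u ∈ S)) ≠ α (i + 2) (decide (w ∈ S)))
    (h₃ : ∀ i y s, IsHoleApex G c i y → α i s ≠ β i)
    (h₄ : ∀ i y, IsHoleApex G c i y → α (i + 2) false ≠ β i)
    (h₅ : ∀ i y, IsHoleApex G c i y → α (i - 2) false ≠ β i) :
    ∃ f : V → Fin 3, (∀ u v, (∃ j, G.Adj u (c j)) → (∃ j, G.Adj v (c j)) → G.Adj u v →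
      f u ≠ f v) ∧ ∀ i y, IsHoleApex G c i y → f y = β i := by
  classical
  have cloneInj : ∀ i j : ZMod 5, (∀ k, k = i + 1 ∨ k = i - 1 ↔ k = j + 1 ∨ k = j - 1) → i = j := by
    decide
  have apexInj : ∀ i j : ZMod 5, (∀ k, k = i ∨ k = i + 2 ∨ k = i - 2 ↔
      k = j ∨ k = j + 2 ∨ k = j - 2) → i = j := by decide
  have apexClone : ∀ i j : ZMod 5, ¬ ∀ k, k = i ∨ k = i + 2 ∨ k = i - 2 ↔
      k = j + 1 ∨ k = j - 1 := by decide
  let f : V → Fin 3 := fun v =>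
    if h : ∃ i, IsHoleClone G c i v then α h.choose (decide (v ∈ S))
    else if h : ∃ i, IsHoleApex G c i v then β h.choose else 0
  have fClone : ∀ i v, IsHoleClone G c i v → f v = α i (decide (v ∈ S)) := fun i v hv => by
    have h : ∃ i, IsHoleClone G c i v := ⟨i, hv⟩
    have hi : h.choose = i := cloneInj _ _ fun k => (h.choose_spec k).symm.trans (hv k)
    simp only [f, dif_pos h, hi]
  have fApex : ∀ i v, IsHoleApex G c i v → f v = β i := fun i v hv => by
    have h : ∃ i, IsHoleApex G c i v := ⟨i, hv⟩
    have hi : h.choose = i := apexInj _ _ fun k => (h.choose_spec k).symm.trans (hv k)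
    have h' : ¬ ∃ i, IsHoleClone G c i v := fun ⟨j, hj⟩ =>
      apexClone i j fun k => (hv k).symm.trans (hj k)
    simp only [f, dif_neg h', dif_pos h, hi]
  have diff : ∀ i j : ZMod 5, i = j ∨ j = i + 1 ∨ i = j + 1 ∨ j = i + 2 ∨ i = j + 2 := by decide
  have mixed : ∀ i j y u, IsHoleApex G c i y → IsHoleClone G c j u → G.Adj y u → f y ≠ f u := by
    intro i j y u hy hu hyu
    rw [fApex i y hy, fClone j u hu]
    have huS : u ∉ S := fun h => hS (hYS i y hy) h hyu
    rcases diff i j with rfl | rfl | rfl | rfl | rfl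
    · exact (h₃ _ y _ hy).symm
    · exact (hy.not_adj_clone_succ hG hc hu hyu).elim
    · exact (hy.not_adj_clone_pred hG hc hu hyu).elim
    · simpa [huS] using (h₄ _ y hy).symm
    · simpa [huS] using (h₅ _ y hy).symm
  refine ⟨f, fun u v hu hv huv => ?_, fApex⟩
  rcases hc.classify hP hG u with hu' | ⟨i, hu⟩ | ⟨i, hu⟩
  · exact absurd hu (not_exists.2 hu')
  · rcases hc.classify hP hG v with hv' | ⟨j, hv⟩ | ⟨j, hv⟩
    · exact absurd hv (not_exists.2 hv')
    · rw [fClone i u hu, fClone j v hv]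
      rcases diff i j with rfl | rfl | rfl | rfl | rfl
      · exact (hu.not_adj hG hc hv huv).elim
      · exact h₁ _ _ _
      · exact (h₁ _ _ _).symm
      · exact h₂ _ _ _ hu hv huv
      · exact (h₂ _ _ _ hv hu huv.symm).symm
    · exact (mixed j i v u hv hu huv.symm).symm
  · rcases hc.classify hP hG v with hv' | ⟨j, hv⟩ | ⟨j, hv⟩
    · exact absurd hv (not_exists.2 hv')
    · exact mixed i j u v hu hv huv
    · exact (hS (hYS i u hu) (hYS j v hv) huv).elim

/-- The vertices with a neighbour on a 5-hole avoided by a stable transversal of the triangles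
can be coloured such that the colour of an apex depends only on its position. -/
lemma IsFiveHole.exists_coloring (hP : P5Free G) (hG : ShortCyclePerfect G) (hc : IsFiveHole G c)
    {S : Set V} (hS : IsStable G S) (hYS : ∀ i y, IsHoleApex G c i y → y ∈ S)
    (htri : ∀ u v w, G.Adj u v → G.Adj v w → G.Adj w u → u ∈ S ∨ v ∈ S ∨ w ∈ S)
    (hcS : ∀ i, c i ∉ S) :
    ∃ (f : V → Fin 3) (β : ZMod 5 → Fin 3), (∀ u v, (∃ j, G.Adj u (c j)) →
      (∃ j, G.Adj v (c j)) → G.Adj u v → f u ≠ f v) ∧ ∀ i y, IsHoleApex G c i y → f y = β i := by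
  classical
  have cross : ∀ i u w, IsHoleClone G c i u → IsHoleClone G c (i + 2) w → G.Adj u w →
      u ∈ S ∨ w ∈ S := fun i u w hu hw huw => by
    have := htri u w (c (i + 1)) huw ((hw _).2 (Or.inr (by ring))) ((hu _).2 (Or.inl rfl)).symm
    simpa [hcS] using this
  let P : ZMod 5 → Prop := fun i => ∃ u, IsHoleClone G c i u ∧ u ∈ S
  have hPS : ∀ i u, IsHoleClone G c i u → u ∈ S → P i := fun i u hu huS => ⟨u, hu, huS⟩
  have hPsucc : ∀ i, P i → ¬ P (i + 1) := fun i ⟨u, hu, huS⟩ ⟨w, hw, hwS⟩ =>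
    hS huS hwS (hu.adj_of_succ hP hc hw)
  have hPapex : ∀ i y, P i → ¬ IsHoleApex G c i y := fun i y ⟨u, hu, huS⟩ hy =>
    hS (hYS i y hy) huS (hy.adj_clone hP hc hu)
  have dichotomy : (∃ i, P i ∧ P (i + 2)) ∨
      ∃ i, (∀ j, P j → j = i) ∧ ∀ y, ¬ IsHoleApex G c i y := by
    by_cases h : ∃ i, P i
    · obtain ⟨i, hi⟩ := h
      by_cases h2 : ∃ i, P i ∧ P (i + 2)
      · exact Or.inl h2
      · refine Or.inr ⟨i, fun j hj => ?_, fun y => hPapex i y hi⟩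
        have diff : ∀ i j : ZMod 5, i = j ∨ j = i + 1 ∨ i = j + 1 ∨ j = i + 2 ∨ i = j + 2 := by
          decide
        rcases diff i j with rfl | rfl | rfl | rfl | rfl
        · rfl
        · exact (hPsucc _ hi hj).elim
        · exact (hPsucc _ hj hi).elim
        · exact (h2 ⟨_, hi, hj⟩).elim
        · exact (h2 ⟨_, hj, hi⟩).elim
    · obtain ⟨i, hi⟩ := hc.exists_no_apex hP hS hYS
      exact Or.inr ⟨i, fun j hj => (h ⟨j, hj⟩).elim, hi⟩
  rcases dichotomy with ⟨i, hi, hi2⟩ | ⟨i, hi, hYi⟩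
  · have hPonly : ∀ j, P j → j = i ∨ j = i + 2 := fun j hj => by
      have h1 := hPsucc _ hi
      have h2 := hPsucc _ hi2
      have h3 : j + 1 = i → False := fun h => hPsucc j hj (h ▸ hi)
      have key : ∀ i j : ZMod 5, j = i ∨ j = i + 1 ∨ j = i + 2 ∨ j = i + 2 + 1 ∨ j + 1 = i := by
        decide
      rcases key i j with h | rfl | h | rfl | h
      · exact Or.inl h
      · exact (h1 hj).elim
      · exact Or.inr h
      · exact (h2 hj).elim
      · exact (h3 h).elim
    have hYonly : ∀ j y, IsHoleApex G c j y → j ≠ i ∧ j ≠ i + 2 := fun j y hy =>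
      ⟨fun h => hPapex _ y hi (h ▸ hy), fun h => hPapex _ y hi2 (h ▸ hy)⟩
    by_cases hE : ∃ u w, IsHoleClone G c i u ∧ u ∉ S ∧ IsHoleClone G c (i + 2) w ∧ w ∈ S ∧
        G.Adj u w
    · have hE' : ∀ u w, IsHoleClone G c i u → u ∈ S → IsHoleClone G c (i + 2) w → w ∉ S →
          ¬ G.Adj u w := by
        intro u' w' hu' huS' hw' hwS' huw'
        obtain ⟨u, w, hu, huS, hw, hwS, huw⟩ := hE
        have huw'' : ¬ G.Adj u w' := fun h => (cross _ _ _ hu hw' h).elim huS hwS'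
        refine hP.false_of_path (a := u) (b := w) (c := c (i + 3)) (d := w') (e := u')
          huw ?_ ?_ huw'.symm ?_ huw'' (hu.not_adj hG hc hu') (hw.not_adj hG hc hw')
          (hS hwS huS') ?_ <;>
          simp only [hu _, hw _, hw'.adj_comm, hu'.adj_comm] <;> clear * - i <;> revert i <;> decide
      let α : ZMod 5 → Bool → Fin 3 := fun k s =>
        if k = 0 then (if s then 2 else 1) else ![0, 0, 2, 1, 0] k
      let β : ZMod 5 → Fin 3 := ![0, 2, 0, 2, 1]
      refine (exists_coloring_of_tables hP hG hc hS hYS (fun j => α (j - i))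
        (fun j => β (j - i)) ?_ ?_ ?_ ?_ ?_).imp fun f hf => ⟨_, hf⟩
      · intro j s t
        have key : ∀ (i j : ZMod 5) (s t : Bool), α (j - i) s ≠ α (j + 1 - i) t := by
          clear * -
          decide
        exact key i j s t
      · intro j u w hu hw huw
        have key : ∀ (i j : ZMod 5) (s t : Bool), (s = true → j = i ∨ j = i + 2) →
            (t = true → j + 2 = i ∨ j + 2 = i + 2) → (s = true ∨ t = true) →
            ¬ (j = i ∧ s = true ∧ t = false) → ¬ (s = true ∧ t = true) →
            α (j - i) s ≠ α (j + 2 - i) t := by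
          clear * -
          decide
        refine key i j _ _ ?_ ?_ ?_ ?_ ?_
        · simpa using fun h => hPonly j (hPS j u hu h)
        · simpa using fun h => hPonly _ (hPS _ w hw h)
        · simpa using cross j u w hu hw huw
        · rintro ⟨rfl, hs, ht⟩
          exact hE' u w hu (by simpa using hs) hw (by simpa using ht) huw
        · rintro ⟨hs, ht⟩
          exact hS (by simpa using hs) (by simpa using ht) huw
      · intro j y s hy
        have key : ∀ (i j : ZMod 5) (s : Bool), j ≠ i ∧ j ≠ i + 2 → α (j - i) s ≠ β (j - i) := by
          clear * -
          decide
        exact key i j s (hYonly j y hy)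
      · intro j y hy
        have key : ∀ i j : ZMod 5, j ≠ i ∧ j ≠ i + 2 → α (j + 2 - i) false ≠ β (j - i) := by
          clear * -
          decide
        exact key i j (hYonly j y hy)
      · intro j y hy
        have key : ∀ i j : ZMod 5, j ≠ i ∧ j ≠ i + 2 → α (j - 2 - i) false ≠ β (j - i) := by
          clear * -
          decide
        exact key i j (hYonly j y hy)
    · let α : ZMod 5 → Bool → Fin 3 := fun k s =>
        if k = 2 then (if s then 2 else 1) else ![2, 0, 0, 0, 1] k
      let β : ZMod 5 → Fin 3 := ![0, 2, 0, 1, 2]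
      refine (exists_coloring_of_tables hP hG hc hS hYS (fun j => α (j - i))
        (fun j => β (j - i)) ?_ ?_ ?_ ?_ ?_).imp fun f hf => ⟨_, hf⟩
      · intro j s t
        have key : ∀ (i j : ZMod 5) (s t : Bool), α (j - i) s ≠ α (j + 1 - i) t := by
          clear * -
          decide
        exact key i j s t
      · intro j u w hu hw huw
        have key : ∀ (i j : ZMod 5) (s t : Bool), (s = true → j = i ∨ j = i + 2) →
            (t = true → j + 2 = i ∨ j + 2 = i + 2) → (s = true ∨ t = true) →
            ¬ (j = i ∧ s = false ∧ t = true) → ¬ (s = true ∧ t = true) →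
            α (j - i) s ≠ α (j + 2 - i) t := by
          clear * -
          decide
        refine key i j _ _ ?_ ?_ ?_ ?_ ?_
        · simpa using fun h => hPonly j (hPS j u hu h)
        · simpa using fun h => hPonly _ (hPS _ w hw h)
        · simpa using cross j u w hu hw huw
        · rintro ⟨rfl, hs, ht⟩
          exact hE ⟨u, w, hu, by simpa using hs, hw, by simpa using ht, huw⟩
        · rintro ⟨hs, ht⟩
          exact hS (by simpa using hs) (by simpa using ht) huw
      · intro j y s hy
        have key : ∀ (i j : ZMod 5) (s : Bool), j ≠ i ∧ j ≠ i + 2 → α (j - i) s ≠ β (j - i) := by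
          clear * -
          decide
        exact key i j s (hYonly j y hy)
      · intro j y hy
        have key : ∀ i j : ZMod 5, j ≠ i ∧ j ≠ i + 2 → α (j + 2 - i) false ≠ β (j - i) := by
          clear * -
          decide
        exact key i j (hYonly j y hy)
      · intro j y hy
        have key : ∀ i j : ZMod 5, j ≠ i ∧ j ≠ i + 2 → α (j - 2 - i) false ≠ β (j - i) := by
          clear * -
          decide
        exact key i j (hYonly j y hy)
  · let α : ZMod 5 → Fin 3 := ![2, 0, 1, 0, 1]
    let β : ZMod 5 → Fin 3 := ![0, 2, 0, 1, 2]
    have hne : ∀ j y, IsHoleApex G c j y → j ≠ i := fun j y hy h => hYi y (h ▸ hy)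
    refine (exists_coloring_of_tables hP hG hc hS hYS (fun j _ => α (j - i))
      (fun j => β (j - i)) ?_ ?_ ?_ ?_ ?_).imp fun f hf => ⟨_, hf⟩
    · intro j s t
      have key : ∀ (i j : ZMod 5), α (j - i) ≠ α (j + 1 - i) := by
        clear * -
        decide
      exact key i j
    · intro j u w hu hw huw
      have key : ∀ i j : ZMod 5, j = i ∨ j + 2 = i → α (j - i) ≠ α (j + 2 - i) := by
        clear * -
        decide
      exact key i j ((cross j u w hu hw huw).imp (fun h => hi _ (hPS _ _ hu h))
        (fun h => hi _ (hPS _ _ hw h)))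
    · intro j y s hy
      have key : ∀ i j : ZMod 5, j ≠ i → α (j - i) ≠ β (j - i) := by
        clear * -
        decide
      exact key i j (hne j y hy)
    · intro j y hy
      have key : ∀ i j : ZMod 5, j ≠ i → α (j + 2 - i) ≠ β (j - i) := by
        clear * -
        decide
      exact key i j (hne j y hy)
    · intro j y hy
      have key : ∀ i j : ZMod 5, j ≠ i → α (j - 2 - i) ≠ β (j - i) := by
        clear * -
        decide
      exact key i j (hne j y hy)

end Structure

section Colouring

variable {V : Type} {G : SimpleGraph V}

lemma IsFiveHole.of_comap {W : Type} {f : W ↪ V} {c : ZMod 5 → W}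
    (hc : IsFiveHole (G.comap f) c) : IsFiveHole G (f ∘ c) :=
  ⟨f.injective.comp hc.1, hc.2⟩

/-- The vertices that have no neighbour on a 5-hole but are adjacent to an apex of it, and hence
to no second position of apexes, induce a bipartite graph. -/
lemma IsFiveHole.colorable_two_of_apex_adj {c : ZMod 5 → V} (hP : P5Free G)
    (hG : ShortCyclePerfect G) (hc : IsFiveHole G c) {S : Set V} (hS : IsStable G S)
    (hYS : ∀ i y, IsHoleApex G c i y → y ∈ S)
    (htri : ∀ u v w, G.Adj u v → G.Adj v w → G.Adj w u → u ∈ S ∨ v ∈ S ∨ w ∈ S) :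
    (G.induce {z | (∀ j, ¬ G.Adj z (c j)) ∧ ∃ i y, IsHoleApex G c i y ∧ G.Adj z y}).Colorable
      2 := by
  refine (hP.comap (Function.Embedding.subtype _)).colorable_two ?_ ?_
  · have notMem : ∀ z, (∃ i y, IsHoleApex G c i y ∧ G.Adj z y) → z ∉ S :=
      fun z ⟨i, y, hy, hzy⟩ hz => hS hz (hYS i y hy) hzy
    rintro ⟨u, _, hu⟩ ⟨v, _, hv⟩ ⟨w, _, hw⟩ huv hvw hwu
    rcases htri u v w huv hvw hwu with h | h | h
    exacts [notMem u hu h, notMem v hv h, notMem w hw h]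
  · intro d hd
    obtain ⟨i, y, hy, h0⟩ := (d 0).2.2
    have step : ∀ j, G.Adj (d j) y → G.Adj (d (j + 1)) y := fun j =>
      hy.adj_of_adj_far hP hc (d j).2.1 (d (j + 1)).2.1 ((hd.2 _ _).2 (Or.inl rfl))
    have h1 := step 0 h0
    have h2 := step _ h1
    have h3 := step _ h2
    have h4 := step _ h3
    have cover : ∀ j : ZMod 5, j = 0 ∨ j = 0 + 1 ∨ j = 0 + 1 + 1 ∨ j = 0 + 1 + 1 + 1 ∨
        j = 0 + 1 + 1 + 1 + 1 := by decide
    refine hd.of_comap.not_adj_all hG (v := y) fun j => G.adj_symm ?_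
    rcases cover j with rfl | rfl | rfl | rfl | rfl
    exacts [h0, h1, h2, h3, h4]

/-- A 3-colouring of the vertices without neighbours on a 5-hole and on its apexes extends to the
whole graph. -/
lemma IsFiveHole.colorable_three {c : ZMod 5 → V} (hP : P5Free G) (hG : ShortCyclePerfect G)
    (hc : IsFiveHole G c) {S : Set V} (hS : IsStable G S)
    (htri : ∀ u v w, G.Adj u v → G.Adj v w → G.Adj w u → u ∈ S ∨ v ∈ S ∨ w ∈ S)
    (hcS : ∀ i, c i ∉ S)
    (hfar : (G.induce {z | (∀ j, ¬ G.Adj z (c j)) ∧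
      ¬ ∃ i y, IsHoleApex G c i y ∧ G.Adj z y}).Colorable 3) : G.Colorable 3 := by
  classical
  have hYS : ∀ i y, IsHoleApex G c i y → y ∈ S := fun i y hy => by
    have := htri y (c (i + 2)) (c (i - 2)) ((hy _).2 (by simp))
      ((hc.2 _ _).2 (Or.inl (by clear * -; revert i; decide))) ((hy.adj_comm _).2 (by simp))
    simpa [hcS] using this
  obtain ⟨f, β, hf, hfβ⟩ := hc.exists_coloring hP hG hS hYS htri hcS
  obtain ⟨g⟩ := hc.colorable_two_of_apex_adj hP hG hS hYS htri
  obtain ⟨h⟩ := hfar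
  let Near : V → Prop := fun z => ∃ i y, IsHoleApex G c i y ∧ G.Adj z y
  let k : V → Fin 3 := fun v =>
    if hv : ∀ j, ¬ G.Adj v (c j) then
      if hn : Near v then β hn.choose + 1 + (g ⟨v, hv, hn⟩).castSucc else h ⟨v, hv, hn⟩
    else f v
  have kNear : ∀ v i y (hv : ∀ j, ¬ G.Adj v (c j)) (hy : IsHoleApex G c i y)
      (hvy : G.Adj v y), k v = β i + 1 + (g ⟨v, hv, i, y, hy, hvy⟩).castSucc := by
    intro v i y hv hy hvy
    have hn : Near v := ⟨i, y, hy, hvy⟩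
    have hi : hn.choose = i := by
      obtain ⟨y', hy', hvy'⟩ := hn.choose_spec
      by_contra hne
      exact hy'.not_common_adj hG hc hy hne (hS (hYS _ _ hy') (hYS _ _ hy)) hv hvy' hvy
    simp only [k, dif_pos hv, dif_pos hn, hi]
  have kMixed : ∀ u v, (∃ j, G.Adj u (c j)) → (∀ j, ¬ G.Adj v (c j)) → G.Adj u v →
      k u ≠ k v := by
    intro u v hu hv huv
    have hu' : ¬ ∀ j, ¬ G.Adj u (c j) := by simpa using hu
    rcases hc.classify hP hG u with h' | ⟨i, hi⟩ | ⟨i, hi⟩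
    · exact (hu' h').elim
    · exact (hi.not_adj_far hP hc hv huv.symm).elim
    · have hku : k u = β i := by simp only [k, dif_neg hu', hfβ i u hi]
      rw [hku, kNear v i u hv hi huv.symm]
      have key : ∀ (a : Fin 3) (b : Fin 2), a ≠ a + 1 + b.castSucc := by decide
      exact key _ _
  refine ⟨Coloring.mk k fun {u v} huv => ?_⟩
  by_cases hu : ∀ j, ¬ G.Adj u (c j)
  · by_cases hv : ∀ j, ¬ G.Adj v (c j)
    · by_cases hn : Near u
      · obtain ⟨i, y, hy, huy⟩ := hn
        have hvy := hy.adj_of_adj_far hP hc hu hv huv huy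
        rw [kNear u i y hu hy huy, kNear v i y hv hy hvy]
        have key : ∀ (a : Fin 3) (b b' : Fin 2), b ≠ b' →
            a + 1 + b.castSucc ≠ a + 1 + b'.castSucc := by decide
        exact key _ _ _ (g.valid huv)
      · have hn' : ¬ Near v := fun ⟨i, y, hy, hvy⟩ =>
          hn ⟨i, y, hy, hy.adj_of_adj_far hP hc hv hu huv.symm hvy⟩
        simp only [k, dif_pos hu, dif_pos hv, dif_neg hn, dif_neg hn']
        exact h.valid huv
    · exact (kMixed v u (by simpa using hv) hu huv.symm).symm
  · by_cases hv : ∀ j, ¬ G.Adj v (c j)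
    · exact kMixed u v (by simpa using hu) hv huv
    · simp only [k, dif_neg hu, dif_neg hv]
      exact hf u v (by simpa using hu) (by simpa using hv) huv

lemma IsStable.colorable_succ {S : Set V} (hS : IsStable G S) {n : ℕ}
    (h : (G.induce Sᶜ).Colorable n) : G.Colorable (n + 1) := by
  classical
  obtain ⟨g⟩ := h
  refine ⟨Coloring.mk (fun v => if hv : v ∈ S then Fin.last n else (g ⟨v, hv⟩).castSucc)
    fun {u v} huv => ?_⟩
  by_cases hu : u ∈ S <;> by_cases hv : v ∈ S
  · exact (hS hu hv huv).elim
  · simp [hu, hv, (Fin.castSucc_lt_last _).ne']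
  · simp [hu, hv, (Fin.castSucc_lt_last _).ne]
  · simpa [hu, hv] using g.valid (v := ⟨u, hu⟩) (w := ⟨v, hv⟩) huv

theorem ShortCyclePerfect.colorable_three [Fintype V] (hP : P5Free G)
    (hG : ShortCyclePerfect G) : G.Colorable 3 := by
  classical
  induction hn : Fintype.card V using Nat.strong_induction_on generalizing V with
  | _ n ih =>
    subst hn
    obtain ⟨S, hS, htri⟩ := hG.exists_stable_transversal
    by_cases h5 : ∃ c, IsFiveHole (G.induce Sᶜ) c
    · obtain ⟨c, hc⟩ := h5
      have hc' : IsFiveHole G (fun j => (c j).1) := hc.of_comap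
      refine hc'.colorable_three hP hG hS htri (fun j => (c j).2) ?_
      refine ih _ ?_ (hP.comap (Function.Embedding.subtype _))
        (hG.comap (Function.Embedding.subtype _)) rfl
      exact Fintype.card_subtype_lt (x := (c 0).1) fun h =>
        h.1 1 ((hc'.2 0 1).2 (Or.inl (zero_add 1).symm))
    · refine hS.colorable_succ ((hP.comap (Function.Embedding.subtype _)).colorable_two ?_
        (not_exists.1 h5))
      rintro ⟨u, hu⟩ ⟨v, hv⟩ ⟨w, hw⟩ huv hvw hwu
      rcases htri u v w huv hvw hwu with h | h | h
      exacts [hu h, hv h, hw h]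

end Colouring

/-- **Theorem 19.** Every finite simple `P5`-free t-perfect graph is 3-colourable. -/
theorem p5free_tperfect_colorable_three {V : Type} [Fintype V]
    (G : SimpleGraph V) (hP5 : P5Free G) (htp : TPerfect G) :
    G.Colorable 3 :=
  ShortCyclePerfect.colorable_three hP5 (htp.shortCyclePerfect hP5)
end
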